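/- arXiv:2511.07214 — 4 statements merged into one kernel-verified Lean document; each statement's English description precedes it below -/
import Mathlib

section
/- Let s ∈ (3/2, 2), n ≥ 1, and let k : ℝ → ℝⁿ be 1-periodic and locally integrable. Then ∫₀¹ ∫_{−1/2}^{1/2} |w|^{−(2s+1)} · | ∫_x^{x+w} (k(θ) − k(x)) dθ |² dw dx ≤ (1/(2s)) · ∫₀¹ ∫_{−1/2}^{1/2} |z|^{−(2s−1)} · |k(x+z) − k(x)|² dz dx (an inequality in [0,∞]). -/
open MeasureTheory
open scoped ENNReal

theorem Function.Periodic.setLIntegral_Ioc_comp_add {f : ℝ → ℝ≥0∞} (hf : Function.Periodic f 1)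
    (a b : ℝ) : ∫⁻ x in Set.Ioc a (a + 1), f (x + b) = ∫⁻ x in Set.Ioc 0 1, f x := by
  have : VAddInvariantMeasure (AddSubgroup.zmultiples (1 : ℝ)) ℝ volume :=
    ⟨fun c s _ => measure_preimage_add _ _ _⟩
  have key : ∀ c d : ℝ, ∫⁻ x in Set.Ioc c (c + 1), f x = ∫⁻ x in Set.Ioc d (d + 1), f x := by
    intro c d
    exact (isAddFundamentalDomain_Ioc one_pos c).setLIntegral_eq
      (isAddFundamentalDomain_Ioc one_pos d) f hf.map_vadd_zmultiples
  have h := (measurePreserving_add_right volume b).setLIntegral_comp_preimage_emb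
    (measurableEmbedding_addRight b) f (Set.Ioc (a + b) (a + b + 1))
  have hs : (fun x => x + b) ⁻¹' Set.Ioc (a + b) (a + b + 1) = Set.Ioc a (a + 1) := by
    ext x
    simp only [Set.mem_preimage, Set.mem_Ioc]
    constructor <;> rintro ⟨h1, h2⟩ <;> constructor <;> linarith
  rw [hs] at h
  rw [h, key (a + b) 0, zero_add]

theorem lintegral_comp_mul_left_real (f : ℝ → ℝ≥0∞) {a : ℝ} (ha : a ≠ 0) :
    ∫⁻ x, f (a * x) = ENNReal.ofReal |a⁻¹| * ∫⁻ x, f x := by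
  have h := (measurableEmbedding_mulLeft₀ ha).lintegral_map (μ := volume) f
  rw [← h, Real.map_volume_mul_left ha, lintegral_smul_measure, smul_eq_mul]

theorem integral_norm_sub_sq_eq {α E : Type*} [MeasurableSpace α] [NormedAddCommGroup E]
    [InnerProductSpace ℝ E] [CompleteSpace E] {μ : Measure α} [IsProbabilityMeasure μ]
    {u : α → E} (hu : MemLp u 2 μ) (v : E) :
    ∫ b, ‖v - u b‖ ^ 2 ∂μ = ‖v‖ ^ 2 - 2 * inner ℝ v (∫ b, u b ∂μ) + ∫ b, ‖u b‖ ^ 2 ∂μ := by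
  have hi : Integrable u μ := hu.integrable (by norm_num)
  have hsq : Integrable (fun a => ‖u a‖ ^ 2) μ := hu.integrable_norm_pow (by norm_num)
  have hin : Integrable (fun b => 2 * inner ℝ v (u b)) μ := (hi.const_inner v).const_mul 2
  have hc : Integrable (fun b => ‖v‖ ^ 2 - 2 * inner ℝ v (u b)) μ := (integrable_const _).sub hin
  simp_rw [norm_sub_sq_real]
  rw [integral_add hc hsq, integral_sub (integrable_const _) hin, integral_const_mul,
    integral_inner hi]
  simp

theorem lintegral_enorm_sub_sq_add {α E : Type*} [MeasurableSpace α] [NormedAddCommGroup E]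
    [InnerProductSpace ℝ E] [CompleteSpace E] {μ : Measure α} [IsProbabilityMeasure μ]
    {u : α → E} (hu : MemLp u 2 μ) :
    ∫⁻ a, ∫⁻ b, ‖u a - u b‖ₑ ^ 2 ∂μ ∂μ + 2 * ‖∫ a, u a ∂μ‖ₑ ^ 2 = 2 * ∫⁻ a, ‖u a‖ₑ ^ 2 ∂μ := by
  have hi : Integrable u μ := hu.integrable (by norm_num)
  have hsq : Integrable (fun a => ‖u a‖ ^ 2) μ := hu.integrable_norm_pow (by norm_num)
  have hof : ∀ v : E, ‖v‖ₑ ^ 2 = ENNReal.ofReal (‖v‖ ^ 2) := fun v => by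
    rw [ENNReal.ofReal_pow (norm_nonneg _), ofReal_norm]
  have hinner : ∀ a, ∫⁻ b, ‖u a - u b‖ₑ ^ 2 ∂μ = ENNReal.ofReal (∫ b, ‖u a - u b‖ ^ 2 ∂μ) := by
    intro a
    have hint : Integrable (fun b => ‖u a - u b‖ ^ 2) μ :=
      ((memLp_const (u a)).sub hu).integrable_norm_pow (by norm_num)
    simp_rw [hof]
    rw [← ofReal_integral_eq_lintegral_ofReal hint (ae_of_all _ fun b => by positivity)]
  have hin : Integrable (fun b => 2 * inner ℝ (u b) (∫ b, u b ∂μ)) μ :=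
    (hi.inner_const _).const_mul 2
  have hc : Integrable (fun b => ‖u b‖ ^ 2 - 2 * inner ℝ (u b) (∫ b, u b ∂μ)) μ := hsq.sub hin
  have hout : Integrable (fun a => ∫ b, ‖u a - u b‖ ^ 2 ∂μ) μ := by
    simp_rw [integral_norm_sub_sq_eq hu]
    exact hc.add (integrable_const _)
  have hnn : ∀ a, 0 ≤ ∫ b, ‖u a - u b‖ ^ 2 ∂μ := fun a => integral_nonneg fun b => by positivity
  have hval : ∫ a, ∫ b, ‖u a - u b‖ ^ 2 ∂μ ∂μ + 2 * ‖∫ a, u a ∂μ‖ ^ 2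
      = 2 * ∫ a, ‖u a‖ ^ 2 ∂μ := by
    simp_rw [integral_norm_sub_sq_eq hu]
    rw [integral_add hc (integrable_const _), integral_sub hsq hin, integral_const_mul]
    simp_rw [real_inner_comm (∫ b, u b ∂μ)]
    rw [integral_inner hi, real_inner_self_eq_norm_sq]
    simp only [integral_const, probReal_univ, one_smul]
    ring
  simp_rw [hinner, hof]
  rw [← ofReal_integral_eq_lintegral_ofReal hout (ae_of_all _ hnn),
    ← ofReal_integral_eq_lintegral_ofReal hsq (ae_of_all _ fun b => by positivity),
    show (2 : ℝ≥0∞) = ENNReal.ofReal 2 by simp, ← ENNReal.ofReal_mul (by norm_num),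
    ← ENNReal.ofReal_mul (by norm_num),
    ← ENNReal.ofReal_add (integral_nonneg hnn) (by positivity), hval]

theorem two_mul_setLIntegral_one_sub_mul_le {h : ℝ → ℝ≥0∞} (hh : Measurable h)
    (heven : ∀ v, h (-v) = h v) :
    2 * ∫⁻ v in Set.Ioc (0 : ℝ) 1, ENNReal.ofReal (1 - v) * h v
      ≤ ∫⁻ a in Set.Ioc (0 : ℝ) 1, ∫⁻ b in Set.Ioc (0 : ℝ) 1, h (a - b) := by
  set g : ℝ → ℝ≥0∞ := (Set.Ioc (0 : ℝ) 1).indicator 1 with hg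
  have hgm : Measurable g := measurable_one.indicator measurableSet_Ioc
  have hrhs : ∫⁻ a in Set.Ioc (0 : ℝ) 1, ∫⁻ b in Set.Ioc (0 : ℝ) 1, h (a - b)
      = ∫⁻ v, ∫⁻ a, g a * g (a - v) * h v := by
    have h1 : ∀ a, ∫⁻ b in Set.Ioc (0 : ℝ) 1, h (a - b) = ∫⁻ v, g (a - v) * h v := by
      intro a
      rw [← lintegral_indicator measurableSet_Ioc,
        ← lintegral_sub_left_eq_self (fun v => g (a - v) * h v) a]
      refine lintegral_congr fun b => ?_
      by_cases hb : b ∈ Set.Ioc (0 : ℝ) 1 <;> simp [hg, hb]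
    simp_rw [h1]
    rw [← lintegral_indicator measurableSet_Ioc, lintegral_lintegral_swap]
    · refine lintegral_congr fun a => ?_
      by_cases ha : a ∈ Set.Ioc (0 : ℝ) 1 <;> simp [hg, ha]
    · fun_prop
  have hvol : ∀ v, ∫⁻ a, g a * g (a - v) * h v = ENNReal.ofReal (1 - |v|) * h v := by
    intro v
    rw [lintegral_mul_const _ (by fun_prop)]
    congr 1
    have : (fun a => g a * g (a - v)) = (Set.Ioc (max 0 v) (min 1 (1 + v))).indicator 1 := by
      ext a
      have : a ∈ Set.Ioc (max 0 v) (min 1 (1 + v))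
          ↔ a ∈ Set.Ioc (0 : ℝ) 1 ∧ a - v ∈ Set.Ioc (0 : ℝ) 1 := by
        simp only [Set.mem_Ioc, max_lt_iff, le_min_iff]
        constructor
        · rintro ⟨⟨_, _⟩, _, _⟩; refine ⟨⟨?_, ?_⟩, ?_, ?_⟩ <;> linarith
        · rintro ⟨⟨_, _⟩, _, _⟩; refine ⟨⟨?_, ?_⟩, ?_, ?_⟩ <;> linarith
      simp only [hg, Set.indicator_apply, this]
      by_cases h1 : a ∈ Set.Ioc (0 : ℝ) 1 <;> by_cases h2 : a - v ∈ Set.Ioc (0 : ℝ) 1 <;>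
        simp [h1, h2]
    rw [this, lintegral_indicator_one measurableSet_Ioc, Real.volume_Ioc]
    congr 1
    rcases le_total 0 v with hv | hv
    · rw [max_eq_right hv, min_eq_left (by linarith), abs_of_nonneg hv]
    · rw [max_eq_left hv, min_eq_right (by linarith), abs_of_nonpos hv]; ring
  rw [hrhs]
  simp_rw [hvol]
  set F : ℝ → ℝ≥0∞ := fun v => ENNReal.ofReal (1 - |v|) * h v with hF
  have hpos : ∫⁻ v in Set.Ioc (0 : ℝ) 1, ENNReal.ofReal (1 - v) * h v
      = ∫⁻ v in Set.Ioc (0 : ℝ) 1, F v :=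
    setLIntegral_congr_fun measurableSet_Ioc fun v hv => by simp [hF, abs_of_pos hv.1]
  have hneg : ∫⁻ v in Set.Ico (-1 : ℝ) 0, F v = ∫⁻ v in Set.Ioc (0 : ℝ) 1, F v := by
    have := (Measure.measurePreserving_neg (volume : Measure ℝ)).setLIntegral_comp_preimage_emb
      (MeasurableEquiv.neg ℝ).measurableEmbedding F (Set.Ico (-1 : ℝ) 0)
    rw [← this]
    have hs : (Neg.neg : ℝ → ℝ) ⁻¹' Set.Ico (-1) 0 = Set.Ioc 0 1 := by
      simp
    rw [hs]
    simp [hF, heven]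
  rw [hpos, two_mul]
  nth_rewrite 1 [← hneg]
  rw [← lintegral_union measurableSet_Ioc]
  · exact setLIntegral_le_lintegral _ _
  · rw [Set.disjoint_left]
    rintro x ⟨_, h1⟩ ⟨h2, _⟩
    linarith

theorem enorm_sub_sq_le {E : Type*} [NormedAddCommGroup E] (a b : E) :
    ‖a - b‖ₑ ^ 2 ≤ 4 * (‖a‖ₑ ^ 2 + ‖b‖ₑ ^ 2) := by
  have h : ‖a - b‖ₑ ≤ 2 * max ‖a‖ₑ ‖b‖ₑ := by
    refine (enorm_sub_le).trans ?_
    rw [two_mul]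
    exact add_le_add (le_max_left _ _) (le_max_right _ _)
  calc ‖a - b‖ₑ ^ 2 ≤ (2 * max ‖a‖ₑ ‖b‖ₑ) ^ 2 := by gcongr
    _ = 4 * max ‖a‖ₑ ‖b‖ₑ ^ 2 := by rw [mul_pow]; norm_num
    _ ≤ 4 * (‖a‖ₑ ^ 2 + ‖b‖ₑ ^ 2) := by
      gcongr
      rcases le_total ‖a‖ₑ ‖b‖ₑ with h | h
      · rw [max_eq_right h]; exact le_add_self
      · rw [max_eq_left h]; exact le_self_add

/-- The squared `L²` distance over one period between `k` and its translate by `a`. -/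
noncomputable def translationEnergy {E : Type*} [NormedAddCommGroup E] (k : ℝ → E) (a : ℝ) :
    ℝ≥0∞ :=
  ∫⁻ x in Set.Ioc (0 : ℝ) 1, ‖k (x + a) - k x‖ₑ ^ 2

section translationEnergy

variable {E : Type*} [NormedAddCommGroup E] {k : ℝ → E}

theorem measurable_translationEnergy (hk : StronglyMeasurable k) :
    Measurable (translationEnergy k) := by
  unfold translationEnergy
  refine Measurable.lintegral_prod_right' (f := fun p : ℝ × ℝ => ‖k (p.2 + p.1) - k p.2‖ₑ ^ 2) ?_
  have h1 : StronglyMeasurable fun p : ℝ × ℝ => k (p.2 + p.1) :=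
    hk.comp_measurable (by fun_prop)
  have h2 : StronglyMeasurable fun p : ℝ × ℝ => k p.2 := hk.comp_measurable (by fun_prop)
  exact (h1.sub h2).enorm.pow_const 2

theorem setLIntegral_enorm_comp_add_sub_comp_add (hper : Function.Periodic k 1) (a b : ℝ) :
    ∫⁻ x in Set.Ioc (0 : ℝ) 1, ‖k (x + a) - k (x + b)‖ₑ ^ 2 = translationEnergy k (a - b) := by
  have hp : Function.Periodic (fun x => ‖k (x + (a - b)) - k x‖ₑ ^ 2) 1 := fun x => by
    simp only [show x + 1 + (a - b) = x + (a - b) + 1 by ring, hper _]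
  have := hp.setLIntegral_Ioc_comp_add 0 b
  rw [zero_add] at this
  rw [translationEnergy, ← this]
  simp only [show ∀ x, x + b + (a - b) = x + a by intro x; ring]

theorem translationEnergy_neg (hper : Function.Periodic k 1) (a : ℝ) :
    translationEnergy k (-a) = translationEnergy k a := by
  rw [← zero_sub, ← setLIntegral_enorm_comp_add_sub_comp_add hper]
  simp_rw [add_zero, ← enorm_neg (k _ - k (_ + a)), neg_sub]
  rfl

theorem translationEnergy_le (hk : StronglyMeasurable k) (hper : Function.Periodic k 1) (a : ℝ) :
    translationEnergy k a ≤ 8 * ∫⁻ x in Set.Ioc (0 : ℝ) 1, ‖k x‖ₑ ^ 2 := by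
  have hp : Function.Periodic (fun x => ‖k x‖ₑ ^ 2) 1 := fun x => by simp only [hper _]
  have h := hp.setLIntegral_Ioc_comp_add 0 a
  rw [zero_add] at h
  calc translationEnergy k a
      ≤ ∫⁻ x in Set.Ioc (0 : ℝ) 1, 4 * (‖k (x + a)‖ₑ ^ 2 + ‖k x‖ₑ ^ 2) :=
        lintegral_mono fun x => enorm_sub_sq_le _ _
    _ = 8 * ∫⁻ x in Set.Ioc (0 : ℝ) 1, ‖k x‖ₑ ^ 2 := by
      rw [lintegral_const_mul' _ _ (by norm_num),
        lintegral_add_right _ (hk.enorm.pow_const 2), h, ← two_mul, ← mul_assoc]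
      norm_num

theorem setLIntegral_average_translate_le [InnerProductSpace ℝ E] [CompleteSpace E]
    (hk : StronglyMeasurable k) (hper : Function.Periodic k 1)
    (hfin : ∫⁻ x in Set.Ioc (0 : ℝ) 1, ‖k x‖ₑ ^ 2 ≠ ∞) (w : ℝ) :
    ∫⁻ x in Set.Ioc (0 : ℝ) 1, ‖∫ t in Set.Ioc (0 : ℝ) 1, (k (x + w * t) - k x)‖ₑ ^ 2
      ≤ ∫⁻ t in Set.Ioc (0 : ℝ) 1, ENNReal.ofReal t * translationEnergy k (w * t) := by
  set ν : Measure ℝ := volume.restrict (Set.Ioc (0 : ℝ) 1) with hν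
  have : IsProbabilityMeasure ν := ⟨by simp [hν]⟩
  have hD : Measurable fun t => translationEnergy k (w * t) :=
    (measurable_translationEnergy hk).comp (by fun_prop)
  have hmeas : StronglyMeasurable fun p : ℝ × ℝ => k (p.1 + w * p.2) - k p.1 :=
    (hk.comp_measurable (by fun_prop)).sub (hk.comp_measurable (by fun_prop))
  have hmeas3 : StronglyMeasurable fun p : ℝ × ℝ × ℝ => k (p.1 + w * p.2.1) - k (p.1 + w * p.2.2) :=
    (hk.comp_measurable (by fun_prop)).sub (hk.comp_measurable (by fun_prop))
  have hswap : ∫⁻ x, ∫⁻ t, ‖k (x + w * t) - k x‖ₑ ^ 2 ∂ν ∂ν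
      = ∫⁻ t, translationEnergy k (w * t) ∂ν :=
    lintegral_lintegral_swap (hmeas.enorm.pow_const 2).aemeasurable
  have hDfin : ∫⁻ t, translationEnergy k (w * t) ∂ν ≠ ∞ := by
    refine ne_top_of_le_ne_top ?_ (lintegral_mono fun t => translationEnergy_le hk hper (w * t))
    simpa using ENNReal.mul_ne_top (by norm_num) hfin
  have hae : ∀ᵐ x ∂ν, ∫⁻ t, ‖k (x + w * t) - k x‖ₑ ^ 2 ∂ν < ∞ := by
    refine ae_lt_top ?_ (hswap ▸ hDfin)
    exact (hmeas.enorm.pow_const 2).lintegral_prod_right'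
  have hvar : ∀ᵐ x ∂ν, ∫⁻ a, ∫⁻ b, ‖k (x + w * a) - k (x + w * b)‖ₑ ^ 2 ∂ν ∂ν
      + 2 * ‖∫ t, (k (x + w * t) - k x) ∂ν‖ₑ ^ 2 = 2 * ∫⁻ t, ‖k (x + w * t) - k x‖ₑ ^ 2 ∂ν := by
    filter_upwards [hae] with x hx
    have hu : MemLp (fun t => k (x + w * t) - k x) 2 ν := by
      refine ⟨(hmeas.comp_measurable measurable_prodMk_left).aestronglyMeasurable, ?_⟩
      rw [eLpNorm_lt_top_iff_lintegral_rpow_enorm_lt_top (by norm_num) (by norm_num)]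
      simpa using hx
    simpa using lintegral_enorm_sub_sq_add hu
  have htriple : ∫⁻ x, ∫⁻ a, ∫⁻ b, ‖k (x + w * a) - k (x + w * b)‖ₑ ^ 2 ∂ν ∂ν ∂ν
      = ∫⁻ a, ∫⁻ b, translationEnergy k (w * (a - b)) ∂ν ∂ν := by
    rw [lintegral_lintegral_swap]
    · refine lintegral_congr fun a => ?_
      rw [lintegral_lintegral_swap]
      · refine lintegral_congr fun b => ?_
        rw [mul_sub]
        exact setLIntegral_enorm_comp_add_sub_comp_add hper _ _
      · exact ((hmeas3.comp_measurable
          (g := fun p : ℝ × ℝ => (p.1, a, p.2)) (by fun_prop)).enorm.pow_const 2).aemeasurable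
    · exact (Measurable.lintegral_prod_right' (f := fun q : (ℝ × ℝ) × ℝ =>
        ‖k (q.1.1 + w * q.1.2) - k (q.1.1 + w * q.2)‖ₑ ^ 2) ((hmeas3.comp_measurable
          (g := fun q : (ℝ × ℝ) × ℝ => (q.1.1, q.1.2, q.2))
          (by fun_prop)).enorm.pow_const 2)).aemeasurable
  have htotal := lintegral_congr_ae hvar
  rw [lintegral_add_left, htriple, lintegral_const_mul' _ _ (by norm_num),
    lintegral_const_mul' _ _ (by norm_num), hswap] at htotal
  swap
  · exact Measurable.lintegral_prod_right' (f := fun p : ℝ × ℝ =>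
      ∫⁻ b, ‖k (p.1 + w * p.2) - k (p.1 + w * b)‖ₑ ^ 2 ∂ν)
      (Measurable.lintegral_prod_right' (f := fun q : (ℝ × ℝ) × ℝ =>
        ‖k (q.1.1 + w * q.1.2) - k (q.1.1 + w * q.2)‖ₑ ^ 2) ((hmeas3.comp_measurable
          (g := fun q : (ℝ × ℝ) × ℝ => (q.1.1, q.1.2, q.2))
          (by fun_prop)).enorm.pow_const 2))
  have htri := two_mul_setLIntegral_one_sub_mul_le hD
    (fun v => by rw [mul_neg, translationEnergy_neg hper])
  rw [← hν] at htri
  have hsplit : ∫⁻ t, translationEnergy k (w * t) ∂ν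
      = ∫⁻ t, ENNReal.ofReal (1 - t) * translationEnergy k (w * t) ∂ν
        + ∫⁻ t, ENNReal.ofReal t * translationEnergy k (w * t) ∂ν := by
    rw [← lintegral_add_left (by fun_prop)]
    refine setLIntegral_congr_fun measurableSet_Ioc fun t ht => ?_
    rw [← add_mul, ← ENNReal.ofReal_add (by linarith [ht.2]) ht.1.le]
    simp
  have hA : 2 * ∫⁻ t, ENNReal.ofReal (1 - t) * translationEnergy k (w * t) ∂ν ≠ ∞ :=
    ENNReal.mul_ne_top (by norm_num) (ne_top_of_le_ne_top hDfin (hsplit ▸ le_self_add))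
  rw [hsplit, mul_add] at htotal
  refine (ENNReal.mul_le_mul_iff_right two_ne_zero ENNReal.ofNat_ne_top).1 ?_
  refine (ENNReal.add_le_add_iff_left hA).1 ?_
  rw [← htotal]
  gcongr

theorem setLIntegral_rpow_mul_translationEnergy_comp_mul_le (p : ℝ) {t : ℝ}
    (ht : t ∈ Set.Ioc (0 : ℝ) 1) :
    ∫⁻ w in Set.Ioo (-(1 : ℝ) / 2) (1 / 2),
        ENNReal.ofReal (|w| ^ (-p)) * translationEnergy k (w * t)
      ≤ ENNReal.ofReal (t ^ (p - 1)) * ∫⁻ z in Set.Ioo (-(1 : ℝ) / 2) (1 / 2),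
        ENNReal.ofReal (|z| ^ (-p)) * translationEnergy k z := by
  set J := Set.Ioo (-(1 : ℝ) / 2) (1 / 2)
  set Φ : ℝ → ℝ≥0∞ := J.indicator fun z => ENNReal.ofReal (|z| ^ (-p)) * translationEnergy k z
    with hΦ
  have ht0 := ht.1
  have hle : ∀ w ∈ J, ENNReal.ofReal (|w| ^ (-p)) * translationEnergy k (w * t)
      ≤ ENNReal.ofReal (t ^ p) * Φ (t * w) := by
    intro w hw
    have hmem : t * w ∈ J := by
      constructor <;> nlinarith [hw.1, hw.2, ht.1, ht.2]
    rw [hΦ, Set.indicator_of_mem hmem, ← mul_assoc, ← ENNReal.ofReal_mul (by positivity),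
      abs_mul, abs_of_pos ht0, Real.mul_rpow ht0.le (abs_nonneg _), ← mul_assoc,
      ← Real.rpow_add ht0, add_neg_cancel, Real.rpow_zero, one_mul, mul_comm t]
  calc _ ≤ ∫⁻ w in J, ENNReal.ofReal (t ^ p) * Φ (t * w) :=
        setLIntegral_mono' measurableSet_Ioo hle
    _ ≤ ∫⁻ w, ENNReal.ofReal (t ^ p) * Φ (t * w) := setLIntegral_le_lintegral _ _
    _ = ENNReal.ofReal (t ^ (p - 1)) * ∫⁻ z, Φ z := by
      rw [lintegral_const_mul' _ _ ENNReal.ofReal_ne_top, lintegral_comp_mul_left_real _ ht0.ne',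
        ← mul_assoc, ← ENNReal.ofReal_mul (by positivity), abs_of_pos (by positivity),
        Real.rpow_sub_one ht0.ne', div_eq_mul_inv]
    _ = _ := by rw [hΦ, lintegral_indicator measurableSet_Ioo]

theorem setLIntegral_enorm_sq_ne_top (hk : StronglyMeasurable k)
    (hper : Function.Periodic k 1) {p : ℝ} (hp : 0 ≤ p)
    (hfin : ∫⁻ x in Set.Ioc (0 : ℝ) 1, ∫⁻ z in Set.Ioo (-(1 : ℝ) / 2) (1 / 2),
      ENNReal.ofReal (|z| ^ (-p)) * ‖k (x + z) - k x‖ₑ ^ 2 ≠ ∞) :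
    ∫⁻ x in Set.Ioc (0 : ℝ) 1, ‖k x‖ₑ ^ 2 ≠ ∞ := by
  have hmeas : Measurable fun q : ℝ × ℝ =>
      ENNReal.ofReal (|q.2| ^ (-p)) * ‖k (q.1 + q.2) - k q.1‖ₑ ^ 2 :=
    (by fun_prop : Measurable fun q : ℝ × ℝ => ENNReal.ofReal (|q.2| ^ (-p))).mul
      (((hk.comp_measurable (by fun_prop)).sub (hk.comp_measurable (by fun_prop))).enorm.pow_const 2)
  have hae := ae_lt_top hmeas.lintegral_prod_right' hfin
  obtain ⟨x, hx⟩ : ∃ x, ∫⁻ z in Set.Ioo (-(1 : ℝ) / 2) (1 / 2),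
      ENNReal.ofReal (|z| ^ (-p)) * ‖k (x + z) - k x‖ₑ ^ 2 < ∞ := by
    have : NeZero (volume.restrict (Set.Ioc (0 : ℝ) 1)) := ⟨by simp⟩
    exact hae.exists
  have hper2 : Function.Periodic (fun z => ‖k z‖ₑ ^ 2) 1 := fun z => by simp only [hper _]
  have h := hper2.setLIntegral_Ioc_comp_add (-(1 : ℝ) / 2) x
  rw [← h, show -(1 : ℝ) / 2 + 1 = 1 / 2 by norm_num,
    ← restrict_Ioo_eq_restrict_Ioc]
  have hbound : ∀ᵐ z ∂volume.restrict (Set.Ioo (-(1 : ℝ) / 2) (1 / 2)), ‖k (z + x)‖ₑ ^ 2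
      ≤ 4 * (ENNReal.ofReal (|z| ^ (-p)) * ‖k (x + z) - k x‖ₑ ^ 2 + ‖k x‖ₑ ^ 2) := by
    filter_upwards [ae_restrict_mem measurableSet_Ioo, Measure.ae_ne _ (0 : ℝ)] with z hz hz0
    have h1 : 1 ≤ ENNReal.ofReal (|z| ^ (-p)) := by
      rw [ENNReal.one_le_ofReal]
      refine Real.one_le_rpow_of_pos_of_le_one_of_nonpos (abs_pos.2 hz0) ?_ (by linarith)
      rw [abs_le]
      constructor <;> linarith [hz.1, hz.2]
    have h2 := enorm_sub_sq_le (k (x + z) - k x) (-k x)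
    rw [sub_neg_eq_add, sub_add_cancel, enorm_neg, add_comm x z] at h2
    rw [add_comm x z]
    refine h2.trans ?_
    gcongr
    exact le_mul_of_one_le_left (by positivity) h1
  refine ne_top_of_le_ne_top ?_ (lintegral_mono_ae hbound)
  rw [lintegral_const_mul' _ _ (by norm_num), lintegral_add_right _ measurable_const]
  refine ENNReal.mul_ne_top (by norm_num) (ENNReal.add_ne_top.2 ⟨hx.ne, ?_⟩)
  rw [lintegral_const]
  exact ENNReal.mul_ne_top (by simp) (by simp)

theorem setLIntegral_average_le_gagliardo [InnerProductSpace ℝ E] [CompleteSpace E]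
    (hk : StronglyMeasurable k) (hper : Function.Periodic k 1) {p : ℝ} (hp : 0 ≤ p) :
    ∫⁻ x in Set.Ioc (0 : ℝ) 1, ∫⁻ w in Set.Ioo (-(1 : ℝ) / 2) (1 / 2),
        ENNReal.ofReal (|w| ^ (-p)) * ‖∫ t in Set.Ioc (0 : ℝ) 1, (k (x + w * t) - k x)‖ₑ ^ 2
      ≤ ENNReal.ofReal (1 / (p + 1)) *
        ∫⁻ x in Set.Ioc (0 : ℝ) 1, ∫⁻ z in Set.Ioo (-(1 : ℝ) / 2) (1 / 2),
          ENNReal.ofReal (|z| ^ (-p)) * ‖k (x + z) - k x‖ₑ ^ 2 := by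
  by_cases hfin : ∫⁻ x in Set.Ioc (0 : ℝ) 1, ∫⁻ z in Set.Ioo (-(1 : ℝ) / 2) (1 / 2),
      ENNReal.ofReal (|z| ^ (-p)) * ‖k (x + z) - k x‖ₑ ^ 2 = ∞
  · rw [hfin, ENNReal.mul_top (by simp; linarith)]
    exact le_top
  have hL2 := setLIntegral_enorm_sq_ne_top hk hper hp hfin
  have hweight : Measurable fun w : ℝ => ENNReal.ofReal (|w| ^ (-p)) := by fun_prop
  have hDm := measurable_translationEnergy hk
  have hrhs : ∫⁻ x in Set.Ioc (0 : ℝ) 1, ∫⁻ z in Set.Ioo (-(1 : ℝ) / 2) (1 / 2),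
      ENNReal.ofReal (|z| ^ (-p)) * ‖k (x + z) - k x‖ₑ ^ 2
      = ∫⁻ z in Set.Ioo (-(1 : ℝ) / 2) (1 / 2),
        ENNReal.ofReal (|z| ^ (-p)) * translationEnergy k z := by
    rw [lintegral_lintegral_swap]
    · refine lintegral_congr fun z => ?_
      rw [lintegral_const_mul' _ _ ENNReal.ofReal_ne_top, translationEnergy]
    · exact ((hweight.comp measurable_snd).mul (((hk.comp_measurable (by fun_prop)).sub
        (hk.comp_measurable (by fun_prop))).enorm.pow_const 2)).aemeasurable
  have hint : StronglyMeasurable fun q : ℝ × ℝ =>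
      ∫ t in Set.Ioc (0 : ℝ) 1, (k (q.1 + q.2 * t) - k q.1) :=
    StronglyMeasurable.integral_prod_right' (f := fun r : (ℝ × ℝ) × ℝ =>
      k (r.1.1 + r.1.2 * r.2) - k r.1.1)
      ((hk.comp_measurable (by fun_prop)).sub (hk.comp_measurable (by fun_prop)))
  rw [hrhs, lintegral_lintegral_swap
    ((hweight.comp measurable_snd).mul (hint.enorm.pow_const 2)).aemeasurable]
  set R := ∫⁻ z in Set.Ioo (-(1 : ℝ) / 2) (1 / 2),
    ENNReal.ofReal (|z| ^ (-p)) * translationEnergy k z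
  calc _ = ∫⁻ w in Set.Ioo (-(1 : ℝ) / 2) (1 / 2), ENNReal.ofReal (|w| ^ (-p)) *
        ∫⁻ x in Set.Ioc (0 : ℝ) 1, ‖∫ t in Set.Ioc (0 : ℝ) 1, (k (x + w * t) - k x)‖ₑ ^ 2 :=
        lintegral_congr fun w => lintegral_const_mul' _ _ ENNReal.ofReal_ne_top
    _ ≤ ∫⁻ w in Set.Ioo (-(1 : ℝ) / 2) (1 / 2), ENNReal.ofReal (|w| ^ (-p)) *
        ∫⁻ t in Set.Ioc (0 : ℝ) 1, ENNReal.ofReal t * translationEnergy k (w * t) := by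
        exact lintegral_mono fun w =>
          mul_le_mul_right (setLIntegral_average_translate_le hk hper hL2 w) _
    _ = ∫⁻ w in Set.Ioo (-(1 : ℝ) / 2) (1 / 2), ∫⁻ t in Set.Ioc (0 : ℝ) 1,
        ENNReal.ofReal t * (ENNReal.ofReal (|w| ^ (-p)) * translationEnergy k (w * t)) := by
        refine lintegral_congr fun w => ?_
        rw [← lintegral_const_mul' _ _ ENNReal.ofReal_ne_top]
        exact lintegral_congr fun t => mul_left_comm _ _ _
    _ = ∫⁻ t in Set.Ioc (0 : ℝ) 1, ∫⁻ w in Set.Ioo (-(1 : ℝ) / 2) (1 / 2),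
        ENNReal.ofReal t * (ENNReal.ofReal (|w| ^ (-p)) * translationEnergy k (w * t)) := by
        refine lintegral_lintegral_swap (Measurable.aemeasurable ?_)
        have : Measurable fun q : ℝ × ℝ => translationEnergy k (q.1 * q.2) :=
          hDm.comp (by fun_prop)
        fun_prop
    _ ≤ ∫⁻ t in Set.Ioc (0 : ℝ) 1, ENNReal.ofReal (t ^ p) * R := by
        refine setLIntegral_mono' measurableSet_Ioc fun t ht => ?_
        rw [lintegral_const_mul' _ _ ENNReal.ofReal_ne_top]
        refine (mul_le_mul_right
          (setLIntegral_rpow_mul_translationEnergy_comp_mul_le p ht) _).trans_eq ?_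
        rw [← mul_assoc, ← ENNReal.ofReal_mul ht.1.le, Real.rpow_sub_one ht.1.ne',
          mul_div_cancel₀ _ ht.1.ne']
    _ = ENNReal.ofReal (1 / (p + 1)) * R := by
        rw [lintegral_mul_const _ (by fun_prop)]
        congr 1
        have hi : IntegrableOn (fun t : ℝ => t ^ p) (Set.Ioc 0 1) :=
          (intervalIntegrable_iff_integrableOn_Ioc_of_le zero_le_one).1
            (intervalIntegral.intervalIntegrable_rpow' (by linarith))
        rw [← ofReal_integral_eq_lintegral_ofReal hi
          ((ae_restrict_mem measurableSet_Ioc).mono fun t ht => Real.rpow_nonneg ht.1.le p),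
          ← intervalIntegral.integral_of_le zero_le_one, integral_rpow (Or.inl (by linarith))]
        simp [Real.zero_rpow (by linarith : p + 1 ≠ 0)]

end translationEnergy

theorem exists_stronglyMeasurable_periodic_ae_eq {E : Type*} [NormedAddCommGroup E] {k : ℝ → E}
    (hk : AEStronglyMeasurable k) (hper : Function.Periodic k 1) :
    ∃ g : ℝ → E, StronglyMeasurable g ∧ Function.Periodic g 1 ∧ k =ᵐ[volume] g := by
  refine ⟨fun x => hk.mk k (Int.fract x), hk.stronglyMeasurable_mk.comp_measurable measurable_fract,
    fun x => by simp, ?_⟩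
  have h : ∀ m : ℤ, ∀ᵐ x : ℝ, k (x - m) = hk.mk k (x - m) := fun m =>
    (measurePreserving_sub_right volume (m : ℝ)).quasiMeasurePreserving.ae hk.ae_eq_mk
  filter_upwards [ae_all_iff.2 h] with x hx
  have := hx ⌊x⌋
  rw [← Int.self_sub_floor, ← this]
  simpa using (hper.sub_int_mul_eq (x := x) ⌊x⌋).symm

/-- For `s ∈ (3/2, 2)`, `n ≥ 1` and a 1-periodic locally integrable
`k : ℝ → ℝⁿ`, the double integral
`∫₀¹ ∫_{−1/2}^{1/2} |w|^{−(2s+1)} ‖∫_x^{x+w} (k(θ) − k(x)) dθ‖² dw dx`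
is bounded by `(1/(2s))` times the squared Gagliardo seminorm
`∫₀¹ ∫_{−1/2}^{1/2} |z|^{−(2s−1)} ‖k(x+z) − k(x)‖² dz dx`, as an inequality in `[0,∞]`. -/
theorem stmt0 {n : ℕ} (hn : 1 ≤ n) (s : ℝ) (hs : s ∈ Set.Ioo (3/2 : ℝ) 2)
    (k : ℝ → EuclideanSpace ℝ (Fin n))
    (hper : ∀ x, k (x + 1) = k x)
    (hloc : MeasureTheory.LocallyIntegrable k) :
    (∫⁻ x in Set.Icc (0:ℝ) 1, ∫⁻ w in Set.Ioo (-(1:ℝ)/2) (1/2),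
        ENNReal.ofReal (|w| ^ (-(2*s+1)) * ‖∫ θ in x..(x+w), (k θ - k x)‖ ^ 2))
      ≤ ENNReal.ofReal (1/(2*s)) *
        ∫⁻ x in Set.Icc (0:ℝ) 1, ∫⁻ z in Set.Ioo (-(1:ℝ)/2) (1/2),
          ENNReal.ofReal (|z| ^ (-(2*s-1)) * ‖k (x + z) - k x‖ ^ 2) := by
  obtain ⟨g, hg, hgper, hkg⟩ :=
    exists_stronglyMeasurable_periodic_ae_eq hloc.aestronglyMeasurable hper
  have hs0 : 3 / 2 < s := hs.1
  have hmain := setLIntegral_average_le_gagliardo hg hgper (p := 2 * s - 1) (by linarith)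
  rw [sub_add_cancel] at hmain
  rw [← restrict_Ioc_eq_restrict_Icc]
  have hleft : ∀ᵐ x : ℝ, ∫⁻ w in Set.Ioo (-(1:ℝ)/2) (1/2),
        ENNReal.ofReal (|w| ^ (-(2*s+1)) * ‖∫ θ in x..(x+w), (k θ - k x)‖ ^ 2)
      = ∫⁻ w in Set.Ioo (-(1 : ℝ) / 2) (1 / 2), ENNReal.ofReal (|w| ^ (-(2 * s - 1))) *
        ‖∫ t in Set.Ioc (0 : ℝ) 1, (g (x + w * t) - g x)‖ₑ ^ 2 := by
    filter_upwards [hkg] with x hx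
    refine lintegral_congr fun w => ?_
    have hI : ∫ θ in x..(x+w), (k θ - k x)
        = w • ∫ t in Set.Ioc (0 : ℝ) 1, (g (x + w * t) - g x) := by
      rw [← intervalIntegral.integral_of_le zero_le_one,
        intervalIntegral.smul_integral_comp_add_mul (fun θ => g θ - g x)]
      simp only [mul_zero, add_zero, mul_one]
      refine intervalIntegral.integral_congr_ae ?_
      filter_upwards [hkg] with θ hθ _
      rw [hθ, hx]
    rcases eq_or_ne w 0 with rfl | hw
    · rw [abs_zero, Real.zero_rpow (by linarith), Real.zero_rpow (by linarith)]
      simp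
    · have hw' : 0 < |w| := abs_pos.2 hw
      rw [hI, norm_smul, Real.norm_eq_abs, mul_pow, ← mul_assoc, ← Real.rpow_natCast |w| 2,
        ← Real.rpow_add hw', ENNReal.ofReal_mul (by positivity),
        ENNReal.ofReal_pow (norm_nonneg _), ofReal_norm]
      congr 4
      push_cast
      ring
  have hright : ∀ᵐ x : ℝ, ∫⁻ z in Set.Ioo (-(1:ℝ)/2) (1/2),
          ENNReal.ofReal (|z| ^ (-(2*s-1)) * ‖k (x + z) - k x‖ ^ 2)
      = ∫⁻ z in Set.Ioo (-(1 : ℝ) / 2) (1 / 2),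
          ENNReal.ofReal (|z| ^ (-(2 * s - 1))) * ‖g (x + z) - g x‖ₑ ^ 2 := by
    filter_upwards [hkg] with x hx
    have hshift : ∀ᵐ z : ℝ, k (x + z) = g (x + z) :=
      (measurePreserving_add_left volume x).quasiMeasurePreserving.ae hkg
    refine lintegral_congr_ae (ae_restrict_of_ae ?_)
    filter_upwards [hshift] with z hz
    rw [hz, hx, ENNReal.ofReal_mul (by positivity), ENNReal.ofReal_pow (norm_nonneg _),
      ofReal_norm]
  rw [lintegral_congr_ae (ae_restrict_of_ae hleft), lintegral_congr_ae (ae_restrict_of_ae hright)]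
  exact hmain
end

section
/- Let s ∈ (3/2,2) and let γ : ℝ → ℝⁿ be a 1-periodic C¹ curve parametrized by arclength, injective on [0,1), and bi-Lipschitz with constant C ≥ 1. Let h : ℝ → ℝⁿ be 1-periodic and C¹ with ⟨γ'(x), h'(x)⟩ = 0 for all x. Then ∫₀¹ ∫_{−1/2}^{1/2} |⟨Ω^s_γ h(x,w), γ'(x)⟩|² dμ_γ ≤ C^{2s+1} · (1/(2s)) · ‖h'‖_∞² · ∫₀¹ ∫_{−1/2}^{1/2} |γ'(x+z) − γ'(x)|² / |z|^{2s−1} dz dx. -/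
open MeasureTheory
open scoped RealInnerProductSpace ENNReal

noncomputable section

/-- Differentiation with respect to arclength: `D_γ h = h'/|γ'|`
(expressed via the given derivative functions). -/
def Dg {n : ℕ} (γ' h' : ℝ → EuclideanSpace ℝ (Fin n)) (x : ℝ) :
    EuclideanSpace ℝ (Fin n) :=
  ‖γ' x‖⁻¹ • h' x

/-- `L_γ h(x,w) = Δ_w h(x) − D_γ h(x) ⟨D_γ γ(x), Δ_w γ(x)⟩`. -/
def Lg {n : ℕ} (γ γ' h h' : ℝ → EuclideanSpace ℝ (Fin n)) (x w : ℝ) :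
    EuclideanSpace ℝ (Fin n) :=
  (h (x + w) - h x) - ⟪Dg γ' γ' x, γ (x + w) - γ x⟫ • Dg γ' h' x

/-- `Ω^σ_γ h(x,w) = L_γ h(x,w)/|Δ_w γ(x)|^σ`. -/
def Om {n : ℕ} (σ : ℝ) (γ γ' h h' : ℝ → EuclideanSpace ℝ (Fin n)) (x w : ℝ) :
    EuclideanSpace ℝ (Fin n) :=
  (‖γ (x + w) - γ x‖ ^ σ)⁻¹ • Lg γ γ' h h' x w

/-- The density of the measure `dμ_γ = |γ'(x)||γ'(x+w)|/|Δ_w γ(x)| dw dx`. -/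
def dens {n : ℕ} (γ γ' : ℝ → EuclideanSpace ℝ (Fin n)) (x w : ℝ) : ℝ :=
  ‖γ' x‖ * ‖γ' (x + w)‖ / ‖γ (x + w) - γ x‖

/-- The tangent-point energy `TP(γ) = ∬ |Ω^s_γ γ|² dμ_γ`, as an element of `[0,∞]`. -/
def TPe {n : ℕ} (s : ℝ) (γ γ' : ℝ → EuclideanSpace ℝ (Fin n)) : ℝ≥0∞ :=
  ∫⁻ x in Set.Icc (0:ℝ) 1, ∫⁻ w in Set.Ioo (-(1:ℝ)/2) (1/2),
    ENNReal.ofReal (‖Om s γ γ' γ γ' x w‖ ^ 2 * dens γ γ' x w)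

end

lemma sq_add_le_sq_of_le_mul_two_sub {Y q : ℝ} (hY : 0 ≤ Y) (hq : 0 ≤ q) (hq2 : q ≤ Y * (2 - Y)) :
    (7/10)^2 + 4 * q ≤ (7/10 + 3/5 * Y + 3/2 * (2 - min 1 (1/4 + 13/5 * Y)) * q)^2 := by
  rcases le_total 1 (1/4 + 13/5 * Y) with h | h
  · rw [min_eq_left h]
    nlinarith [sq_nonneg (9/2 * q - (19/10 - 9/5*Y))]
  · rw [min_eq_right h]
    have hY2 : Y ≤ 15/52 := by linarith
    rcases hY.eq_or_lt with rfl | hYp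
    · have : q = 0 := by linarith
      subst this; norm_num
    obtain ⟨p, rfl⟩ : ∃ p, q = Y * p := ⟨q / Y, by field_simp⟩
    have hp : 0 ≤ p := by
      by_contra hh; push Not at hh
      nlinarith
    have hp2 : p ≤ 2 - Y := le_of_mul_le_mul_left hq2 hYp
    have key : 0 ≤ 21/25 - 13/40 * p - 273/50 * Y * p
        + Y * (3/5 + (21/8 - 39/10 * Y) * p)^2 := by
      have hp3 : 0 ≤ 2 - p := by linarith
      have hlin : 0 ≤ 21/25 - 8/5 * Y + p * (-13/40 + 126/25 * Y - 78/5 * Y^2) := by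
        have e2 : 0 ≤ 19/100 + 212/25 * Y - 156/5 * Y^2 := by nlinarith
        have e0 : 0 ≤ 21/25 - 8/5 * Y := by linarith
        nlinarith [mul_nonneg hp e2, mul_nonneg hp3 e0]
      have hsq := mul_nonneg hY (sq_nonneg (3/5 + (21/8 - 39/10 * Y) * p - 2))
      linarith
    nlinarith [mul_nonneg hYp.le key]

/-- Lower bounds `w / C` and `w (1 - Y)` on a chord, combined with `C² ≥ 2`, improve the trivial
bound on its inverse power by the factor `min 1 (1/4 + 13/5 Y)`. -/
lemma inv_rpow_le_mul_min {s C r w Y : ℝ} (hs : 3/2 < s) (hC : 2 ≤ C^2) (hC0 : 0 < C) (hw : 0 < w)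
    (h1 : w / C ≤ r) (h2 : w * (1 - Y) ≤ r) (hY : 0 ≤ Y) :
    (r ^ (2*s+1))⁻¹ ≤ C ^ (2*s+1) * (min 1 (1/4 + 13/5 * Y) * w ^ (-(2*s+1))) := by
  have hr : 0 < r := lt_of_lt_of_le (by positivity) h1
  have e : (r ^ (2*s+1))⁻¹ = C ^ (2*s+1) * ((w/(C*r)) ^ (2*s+1) * w ^ (-(2*s+1))) := by
    rw [Real.div_rpow hw.le (by positivity), Real.mul_rpow hC0.le hr.le, Real.rpow_neg hw.le]
    have := (Real.rpow_pos_of_pos hr (2*s+1)).ne'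
    have := (Real.rpow_pos_of_pos hw (2*s+1)).ne'
    have := (Real.rpow_pos_of_pos hC0 (2*s+1)).ne'
    field_simp
  have hρ0 : 0 ≤ w/(C*r) := by positivity
  have hρ1 : w/(C*r) ≤ 1 := by
    rw [div_le_one (by positivity)]; rw [div_le_iff₀ hC0] at h1; linarith
  rw [e]
  gcongr
  refine le_min (Real.rpow_le_one hρ0 hρ1 (by linarith)) ?_
  rcases le_or_gt 1 (1/4 + 13/5*Y) with h | h
  · exact (Real.rpow_le_one hρ0 hρ1 (by linarith)).trans h
  have h4 : (w/(C*r)) ^ (2*s+1) ≤ (w/(C*r)) ^ 4 := by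
    rw [← Real.rpow_natCast]
    exact Real.rpow_le_rpow_of_exponent_ge_of_imp hρ0 hρ1 (by norm_num; linarith) (by intro _ h; linarith)
  refine h4.trans ?_
  have hY1 : 0 < 1 - Y := by linarith
  have h5 : (w/(C*r))^2 ≤ 1/(2*(1-Y)^2) := by
    rw [div_pow, div_le_div_iff₀ (by positivity) (by positivity)]
    have : (w * (1-Y))^2 ≤ r^2 := by gcongr
    nlinarith [sq_nonneg r]
  have h6 : (w/(C*r))^4 ≤ (1/(2*(1-Y)^2))^2 := by
    calc (w/(C*r))^4 = ((w/(C*r))^2)^2 := by ring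
      _ ≤ _ := by gcongr
  refine h6.trans ?_
  rw [div_pow, div_le_iff₀ (by positivity)]
  have : 0 ≤ Y * (15/52 - Y) := by apply mul_nonneg hY; linarith
  nlinarith [mul_nonneg hY hY, mul_nonneg hY hY1.le, mul_nonneg this hY, mul_nonneg this this, mul_nonneg (mul_nonneg this hY) hY, mul_nonneg (mul_nonneg this this) hY]

lemma mul_min_le_of_unit_disc {s M Y c g z : ℝ} (hs : 3/2 < s) (hM : 0 ≤ M) (hY : 0 ≤ Y)
    (hcg : M^2 * c^2 + g^2 ≤ M^2) (hz : M^2 * (1-Y)^2 + z^2 ≤ M^2) :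
    s * (min 1 (1/4 + 13/5 * Y) * z^2) ≤
      7/10 * M^2 * (1-c) + (2*s-1) * (3/10) * M^2 * Y + 2 * s * z^2 - 2 * z * g := by
  set θ := min 1 (1/4 + 13/5 * Y) with hθ
  have hθ1 : θ ≤ 1 := min_le_left _ _
  rcases hM.eq_or_lt with rfl | hM
  · have : z = 0 := by nlinarith [sq_nonneg g, sq_nonneg z]
    subst this; simp
  have hq := sq_add_le_sq_of_le_mul_two_sub (Y := Y) (q := (z/M)^2) hY (sq_nonneg _) (by
    rw [div_pow, div_le_iff₀ (by positivity)]; nlinarith)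
  rw [← hθ] at hq
  have e1 : z = M * (z/M) := by field_simp
  have e2 : g = M * (g/M) := by field_simp
  set ζ := z/M
  set k := g/M
  have hck : c^2 + k^2 ≤ 1 := by
    rw [e2] at hcg
    have : M^2 * (c^2+k^2) ≤ M^2 * 1 := by nlinarith
    exact le_of_mul_le_mul_left this (by positivity)
  have h1 : 7/10 * c + 2 * ζ * k ≤ 7/10 + 3/5 * Y + 3/2 * (2 - θ) * ζ^2 := by
    have hb : 0 ≤ 7/10 + 3/5 * Y + 3/2 * (2 - θ) * ζ^2 := by
      have := mul_nonneg (show 0 ≤ 2 - θ by linarith) (sq_nonneg ζ)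
      linarith
    refine (le_abs_self _).trans (abs_le_of_sq_le_sq (le_trans ?_ hq) hb)
    have hcs : (7/10 * c + 2 * ζ * k)^2 ≤ ((7/10)^2 + 4 * ζ^2) * (c^2 + k^2) := by
      linarith [sq_nonneg (7/10 * k - 2 * ζ * c)]
    nlinarith [mul_nonneg (show (0:ℝ) ≤ (7/10)^2 + 4 * ζ^2 by positivity) (sub_nonneg.2 hck)]
  have h2 : 0 ≤ 7/10 * (1-c) + (2*s-1) * (3/10) * Y + s * (2-θ) * ζ^2 - 2 * ζ * k := by
    have a1 : 0 ≤ (s - 3/2) * Y := mul_nonneg (by linarith) hY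
    have a2 : 0 ≤ (s - 3/2) * ((2-θ) * ζ^2) :=
      mul_nonneg (by linarith) (mul_nonneg (by linarith) (sq_nonneg _))
    nlinarith
  rw [e1, e2]
  nlinarith [mul_nonneg (sq_nonneg M) h2]

lemma norm_primitive_le {M w : ℝ} {c g P G : ℝ → ℝ} (hM : 0 ≤ M) (hw : 0 ≤ w)
    (hP : ∀ t, HasDerivAt P (c t) t) (hG : ∀ t, HasDerivAt G (g t) t)
    (hP0 : P 0 = 0) (hG0 : G 0 = 0) (hcg : ∀ t, M^2 * c t^2 + g t^2 ≤ M^2) :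
    M^2 * P w^2 + G w^2 ≤ M^2 * w^2 := by
  set F : ℝ → ℂ := fun t => ((M * P t : ℝ) : ℂ) + ((G t : ℝ) : ℂ) * Complex.I
  have hF : ∀ t, HasDerivAt F (((M * c t : ℝ) : ℂ) + ((g t : ℝ) : ℂ) * Complex.I) t := fun t =>
    ((hP t).const_mul M).ofReal_comp.add ((hG t).ofReal_comp.mul_const _)
  have hn : ∀ a b : ℝ, ‖((a:ℝ):ℂ) + ((b:ℝ):ℂ) * Complex.I‖^2 = a^2+b^2 := fun a b => by
    rw [← Complex.normSq_eq_norm_sq, Complex.normSq_add_mul_I]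
  have h := norm_image_sub_le_of_norm_deriv_le_segment' (f := F) (C := M) (a := 0) (b := w)
    (fun t _ => (hF t).hasDerivWithinAt) (fun t _ => by
      refine (le_abs_self _).trans (abs_le_of_sq_le_sq ?_ hM)
      rw [hn]; nlinarith [hcg t]) w (Set.right_mem_Icc.2 hw)
  have h0 : F 0 = 0 := by simp [F, hP0, hG0]
  rw [h0, sub_zero, sub_zero] at h
  have h2 : ‖F w‖^2 ≤ (M*w)^2 := by gcongr
  rw [hn] at h2
  nlinarith

/-- A Hardy-type inequality with an improved weight: the integrand on the left is dominated by
`M² (1 - c w) w^(1-2s) - Φ'(w)` with `Φ(w) = 3/10 M² (w - P w) w^(1-2s) + G² w^(-2s)`. -/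
lemma hardy_core {s M b : ℝ} (hs : 3/2 < s) (hM : 0 ≤ M) (hb : 0 < b)
    {c g P G : ℝ → ℝ} (hc : Continuous c)
    (hP : ∀ t, HasDerivAt P (c t) t) (hG : ∀ t, HasDerivAt G (g t) t)
    (hP0 : P 0 = 0) (hG0 : G 0 = 0) (hc1 : ∀ t, c t ≤ 1)
    (hcg : ∀ t, M^2 * c t^2 + g t^2 ≤ M^2)
    (hI : IntegrableOn (fun t => (1 - c t) * t ^ (1-2*s)) (Set.Ioo 0 b)) :
    ∫⁻ w in Set.Ioo 0 b, ENNReal.ofReal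
        (s * (min 1 (1/4 + 13/5 * (1 - P w / w)) * (G w ^ 2 * w ^ (-(2*s+1))))) ≤
      ENNReal.ofReal (M^2 * ∫ t in Set.Ioo 0 b, (1 - c t) * t ^ (1-2*s)) := by
  set I : ℝ → ℝ := fun w => ∫ t in (0:ℝ)..w, (1 - c t) * t ^ (1-2*s)
  set Φ : ℝ → ℝ := fun w => 3/10 * M^2 * ((w - P w) * w ^ (1-2*s)) + G w ^ 2 * w ^ (-(2*s))
  have hI' : IntervalIntegrable (fun t => (1 - c t) * t ^ (1-2*s)) volume 0 b := by
    rwa [intervalIntegrable_iff_integrableOn_Ioo_of_le hb.le]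
  have hIcont : ContinuousOn I (Set.Icc 0 b) := by
    have := intervalIntegral.continuousOn_primitive_interval
      (f := fun t => (1 - c t) * t ^ (1-2*s)) (a := 0) (b := b) (μ := volume)
      (by rwa [Set.uIcc_of_le hb.le, integrableOn_Icc_iff_integrableOn_Ioo])
    rwa [Set.uIcc_of_le hb.le] at this
  have hIsub : ∀ w ∈ Set.Icc 0 b,
      IntervalIntegrable (fun t => (1 - c t) * t ^ (1-2*s)) volume 0 w := fun w hw =>
    hI'.mono_set (by rw [Set.uIcc_of_le hb.le, Set.uIcc_of_le hw.1]; exact Set.Icc_subset_Icc_right hw.2)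
  have hpow : ∀ p : ℝ, ∀ w, 0 < w → HasDerivAt (fun w : ℝ => w ^ p) (p * w ^ (p-1)) w :=
    fun p w hw => Real.hasDerivAt_rpow_const (Or.inl hw.ne')
  have hdef : ∀ w, w - P w = ∫ t in (0:ℝ)..w, (1 - c t) := fun w => by
    rw [intervalIntegral.integral_eq_sub_of_hasDerivAt (f := fun t => t - P t)
      (fun t _ => (hasDerivAt_id t).sub (hP t)) ((continuous_const.sub hc).intervalIntegrable _ _)]
    simp [hP0]
  have hPle : ∀ w, 0 ≤ w → P w ≤ w := fun w hw => by
    rw [← sub_nonneg, hdef]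
    exact intervalIntegral.integral_nonneg hw fun t _ => sub_nonneg.2 (hc1 t)
  have hAI : ∀ w, 0 < w → w ≤ b → (w - P w) * w ^ (1-2*s) ≤ I w := fun w hw hwb => by
    rw [hdef, ← intervalIntegral.integral_mul_const]
    refine intervalIntegral.integral_mono_on_of_le_Ioo hw.le
      (((continuous_const.sub hc).mul continuous_const).intervalIntegrable _ _)
      (hIsub w ⟨hw.le, hwb⟩) fun t ht => ?_
    exact mul_le_mul_of_nonneg_left
      (Real.rpow_le_rpow_of_nonpos ht.1 ht.2.le (by linarith)) (by linarith [hc1 t])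
  have hGA : ∀ w, 0 ≤ w → G w ^ 2 ≤ 2 * M^2 * ((w - P w) * w) := fun w hw => by
    have h1 := norm_primitive_le hM hw hP hG hP0 hG0 hcg
    nlinarith [mul_nonneg (sq_nonneg M) (sq_nonneg (w - P w))]
  have hΦ : ∀ w ∈ Set.Icc 0 b, 0 ≤ Φ w ∧ Φ w ≤ 3 * M^2 * I w := fun w hw => by
    rcases hw.1.eq_or_lt with rfl | hw0
    · simp [Φ, hP0, hG0, I]
    have hwp := Real.rpow_pos_of_pos hw0 (1-2*s)
    have hwp2 := Real.rpow_pos_of_pos hw0 (-(2*s))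
    have h1 := hPle w hw0.le
    have h2 := hAI w hw0 hw.2
    have h3 := hGA w hw0.le
    have e : w ^ (1-2*s) = w * w ^ (-(2*s)) := by
      rw [← Real.rpow_one_add' hw0.le (by linarith)]; ring_nf
    have h4 : G w ^ 2 * w ^ (-(2*s)) ≤ 2 * M^2 * ((w - P w) * w ^ (1-2*s)) := by
      rw [e]; nlinarith
    have h0 : 0 ≤ (w - P w) * w ^ (1-2*s) := mul_nonneg (by linarith) hwp.le
    constructor
    · have := mul_nonneg (sq_nonneg M) h0
      simp only [Φ]; positivity
    · simp only [Φ]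
      nlinarith [mul_le_mul_of_nonneg_left h2 (sq_nonneg M), mul_nonneg (sq_nonneg M) h0]
  have hΦcont : ContinuousOn Φ (Set.Icc 0 b) := by
    intro w hw
    rcases hw.1.eq_or_lt with rfl | hw0
    · have h0 : Φ 0 = 0 := by simp [Φ, hP0, hG0]
      have hI0 : I 0 = 0 := by simp [I]
      rw [ContinuousWithinAt, h0]
      have ht : Filter.Tendsto (fun w => 3 * M^2 * I w) (nhdsWithin 0 (Set.Icc 0 b)) (nhds 0) := by
        have := (hIcont 0 hw).tendsto.const_mul (3 * M^2)
        rwa [hI0, mul_zero] at this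
      refine tendsto_of_tendsto_of_tendsto_of_le_of_le' tendsto_const_nhds ht ?_ ?_
      · filter_upwards [self_mem_nhdsWithin] with t ht using (hΦ t ht).1
      · filter_upwards [self_mem_nhdsWithin] with t ht using (hΦ t ht).2
    · have hPc := (hP w).continuousAt
      have hGc := (hG w).continuousAt
      have h1 := (hpow (1-2*s) w hw0).continuousAt
      have h2 := (hpow (-(2*s)) w hw0).continuousAt
      exact ((continuousAt_const.mul ((continuousAt_id.sub hPc).mul h1)).add
        ((hGc.pow 2).mul h2)).continuousWithinAt
  set F : ℝ → ℝ := fun w => M^2 * I w - Φ w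
  set f : ℝ → ℝ := fun w => M^2 * ((1 - c w) * w ^ (1-2*s)) -
    (3/10 * M^2 * ((1 - c w) * w ^ (1-2*s) + (w - P w) * ((1-2*s) * w ^ (1-2*s-1))) +
      ((2 * G w * g w) * w ^ (-(2*s)) + G w ^ 2 * (-(2*s) * w ^ (-(2*s)-1))))
  have hFd : ∀ w ∈ Set.Ioo 0 b, HasDerivAt F (f w) w := fun w hw => by
    have hcont : ContinuousAt (fun t => (1 - c t) * t ^ (1-2*s)) w :=
      (continuous_const.sub hc).continuousAt.mul (hpow _ w hw.1).continuousAt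
    have d1 : HasDerivAt I ((1 - c w) * w ^ (1-2*s)) w := by
      refine intervalIntegral.integral_hasDerivAt_right (hIsub w ⟨hw.1.le, hw.2.le⟩) ?_ hcont
      refine ⟨Set.Ioo 0 b, Ioo_mem_nhds hw.1 hw.2, hI.aestronglyMeasurable⟩
    have d2 := ((hasDerivAt_id w).sub (hP w)).mul (hpow (1-2*s) w hw.1)
    have d3 := ((hG w).pow 2).mul (hpow (-(2*s)) w hw.1)
    refine ((d1.const_mul (M^2)).sub ((d2.const_mul (3/10*M^2)).add d3)).congr_deriv ?_
    simp [f]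
  have hfle : ∀ w ∈ Set.Ioo 0 b,
      s * (min 1 (1/4 + 13/5 * (1 - P w / w)) * (G w ^ 2 * w ^ (-(2*s+1)))) ≤ f w := fun w hw => by
    have hw0 := hw.1
    have hY : 0 ≤ 1 - P w / w := by
      rw [sub_nonneg, div_le_one hw0]; exact hPle w hw0.le
    have hz : M^2 * (1 - (1 - P w / w))^2 + (G w / w)^2 ≤ M^2 := by
      have := norm_primitive_le hM hw0.le hP hG hP0 hG0 hcg
      have e : M^2 * (1 - (1 - P w / w))^2 + (G w / w)^2 = (M^2 * P w^2 + G w^2) / w^2 := by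
        field_simp; ring
      rw [e, div_le_iff₀ (by positivity)]; exact this
    have h := mul_min_le_of_unit_disc hs hM hY (hcg w) hz
    have e1 : w ^ (1-2*s) = w^2 * w ^ (-(2*s+1)) := by
      rw [← Real.rpow_natCast, ← Real.rpow_add hw0]; congr 1; push_cast; ring
    have e2 : w ^ (1-2*s-1) = w * w ^ (-(2*s+1)) := by
      rw [← Real.rpow_one_add' hw0.le (by linarith)]; congr 1; ring
    have e3 : w ^ (-(2*s)) = w * w ^ (-(2*s+1)) := by
      rw [← Real.rpow_one_add' hw0.le (by linarith)]; congr 1; ring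
    have e4 : w ^ (-(2*s)-1) = w ^ (-(2*s+1)) := by congr 1; ring
    simp only [f]
    rw [e1, e2, e3, e4]
    have hp := Real.rpow_pos_of_pos hw0 (-(2*s+1))
    have h' := mul_le_mul_of_nonneg_left h (mul_nonneg (sq_nonneg w) hp.le)
    generalize w ^ (-(2*s+1)) = K at h' ⊢
    generalize min 1 (1/4 + 13/5 * (1 - P w / w)) = θ at h' ⊢
    refine Eq.trans_le ?_ (h'.trans_eq ?_)
    · field_simp
    · field_simp; ring
  have hθ : ∀ w ∈ Set.Ioo 0 b,
      0 ≤ s * (min 1 (1/4 + 13/5 * (1 - P w / w)) * (G w ^ 2 * w ^ (-(2*s+1)))) := fun w hw => by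
    have hY : 0 ≤ 1 - P w / w := by
      rw [sub_nonneg, div_le_one hw.1]; exact hPle w hw.1.le
    have hp := Real.rpow_pos_of_pos hw.1 (-(2*s+1))
    have : 0 ≤ min 1 (1/4 + 13/5 * (1 - P w / w)) := le_min zero_le_one (by linarith)
    positivity
  have hf0 : ∀ w ∈ Set.Ioo 0 b, 0 ≤ f w := fun w hw => (hθ w hw).trans (hfle w hw)
  have hFcont : ContinuousOn F (Set.Icc 0 b) := (continuousOn_const.mul hIcont).sub hΦcont
  have hfint : IntegrableOn f (Set.Ioc 0 b) :=
    intervalIntegral.integrableOn_deriv_of_nonneg hFcont hFd hf0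
  have hFeq : ∫ w in (0:ℝ)..b, f w = F b - F 0 :=
    intervalIntegral.integral_eq_sub_of_hasDerivAt_of_le hb.le hFcont hFd
      ((intervalIntegrable_iff_integrableOn_Ioc_of_le hb.le).2 hfint)
  calc _ ≤ ∫⁻ w in Set.Ioo 0 b, ENNReal.ofReal (f w) :=
        setLIntegral_mono' measurableSet_Ioo fun w hw => ENNReal.ofReal_le_ofReal (hfle w hw)
    _ = ENNReal.ofReal (∫ w in Set.Ioo 0 b, f w) := by
        rw [ofReal_integral_eq_lintegral_ofReal (hfint.mono_set Set.Ioo_subset_Ioc_self)]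
        filter_upwards [ae_restrict_mem measurableSet_Ioo] with w hw using hf0 w hw
    _ ≤ _ := by
        apply ENNReal.ofReal_le_ofReal
        rw [← integral_Ioc_eq_integral_Ioo, ← intervalIntegral.integral_of_le hb.le, hFeq,
          ← integral_Ioc_eq_integral_Ioo, ← intervalIntegral.integral_of_le hb.le]
        have h0 : F 0 = 0 := by simp [F, Φ, I, hP0, hG0]
        have := (hΦ b ⟨hb.le, le_rfl⟩).1
        simp only [h0, F, I] at this ⊢
        linarith

lemma sq_inner_add_sq_inner_le {E : Type*} [NormedAddCommGroup E] [InnerProductSpace ℝ E]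
    {M : ℝ} {e u v : E} (he : ‖e‖ = 1) (hu : ‖u‖ = 1) (huv : ⟪u, v⟫ = 0) (hv : ‖v‖ ≤ M) :
    M^2 * ⟪u, e⟫^2 + ⟪v, e⟫^2 ≤ M^2 := by
  have h1 : ⟪v, e - ⟪u, e⟫ • u⟫ = ⟪v, e⟫ := by
    have hvu : ⟪v, u⟫ = 0 := by rw [real_inner_comm, huv]
    rw [inner_sub_right, inner_smul_right, hvu, mul_zero, sub_zero]
  have h2 : ‖e - ⟪u, e⟫ • u‖^2 = 1 - ⟪u, e⟫^2 := by
    rw [norm_sub_sq_real, inner_smul_right, norm_smul, he, hu, Real.norm_eq_abs, mul_one, sq_abs,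
      real_inner_comm e u]
    ring
  have h3 : ⟪v, e⟫^2 ≤ (‖v‖ * ‖e - ⟪u, e⟫ • u‖)^2 := by
    rw [← h1, ← sq_abs]; gcongr; exact abs_real_inner_le_norm _ _
  have h4 : ‖v‖^2 ≤ M^2 := by gcongr
  rw [mul_pow, h2] at h3
  have h5 : 0 ≤ 1 - ⟪u, e⟫^2 := h2 ▸ sq_nonneg _
  nlinarith [mul_nonneg h5 (sub_nonneg.2 h4)]

lemma norm_sub_sq_of_unit {E : Type*} [NormedAddCommGroup E] [InnerProductSpace ℝ E]
    {u e : E} (hu : ‖u‖ = 1) (he : ‖e‖ = 1) : ‖u - e‖^2 = 2 * (1 - ⟪u, e⟫) := by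
  rw [norm_sub_sq_real, hu, he]; ring

/-- The tangential-projection estimate at a fixed base point, for positive increments. -/
lemma tangential_halfline {E : Type*} [NormedAddCommGroup E] [InnerProductSpace ℝ E]
    {s C M : ℝ} {γ γ' h h' : ℝ → E} (hs : 3/2 < s) (hC0 : 0 < C) (hC : 2 ≤ C^2)
    (hγd : ∀ x, HasDerivAt γ (γ' x) x) (hγc : Continuous γ') (harc : ∀ x, ‖γ' x‖ = 1)
    (hbil : ∀ x w : ℝ, 0 < w → w ≤ 1/2 → w / C ≤ ‖γ (x + w) - γ x‖)
    (hhd : ∀ x, HasDerivAt h (h' x) x) (horth : ∀ x, ⟪γ' x, h' x⟫ = 0)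
    (hhM : ∀ x, ‖h' x‖ ≤ M) (x : ℝ) :
    ∫⁻ w in Set.Ioo (0:ℝ) (1/2), ENNReal.ofReal
        (⟪h (x + w) - h x, γ' x⟫^2 * (‖γ (x + w) - γ x‖ ^ (2*s+1))⁻¹) ≤
      ENNReal.ofReal (C ^ (2*s+1) * (1/(2*s)) * M^2) *
        ∫⁻ z in Set.Ioo (0:ℝ) (1/2),
          ENNReal.ofReal (‖γ' (x + z) - γ' x‖^2 / |z| ^ (2*s-1)) := by
  have hM : 0 ≤ M := (norm_nonneg _).trans (hhM 0)
  set c : ℝ → ℝ := fun t => ⟪γ' (x + t), γ' x⟫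
  set g : ℝ → ℝ := fun t => ⟪h' (x + t), γ' x⟫
  set P : ℝ → ℝ := fun t => ⟪γ (x + t) - γ x, γ' x⟫
  set G : ℝ → ℝ := fun t => ⟪h (x + t) - h x, γ' x⟫
  have hc : Continuous c := (hγc.comp (continuous_const.add continuous_id)).inner continuous_const
  have hd : ∀ {k k' : ℝ → E}, (∀ x, HasDerivAt k (k' x) x) → ∀ t,
      HasDerivAt (fun t => ⟪k (x + t) - k x, γ' x⟫) ⟪k' (x + t), γ' x⟫ t := fun {k _} hk t => by
    have := (((hk (x + t)).comp_const_add x t).sub_const (k x)).inner ℝ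
      (hasDerivAt_const t (γ' x))
    simpa using this
  have hP : ∀ t, HasDerivAt P (c t) t := hd hγd
  have hG : ∀ t, HasDerivAt G (g t) t := hd hhd
  have hP0 : P 0 = 0 := by simp [P]
  have hG0 : G 0 = 0 := by simp [G]
  have hc1 : ∀ t, c t ≤ 1 := fun t => by
    have := real_inner_le_norm (γ' (x + t)) (γ' x)
    rwa [harc, harc, mul_one] at this
  have hcg : ∀ t, M^2 * c t^2 + g t^2 ≤ M^2 := fun t =>
    sq_inner_add_sq_inner_le (harc x) (harc _) (horth _) (hhM _)
  have hR : ∫⁻ z in Set.Ioo (0:ℝ) (1/2), ENNReal.ofReal (‖γ' (x + z) - γ' x‖^2 / |z| ^ (2*s-1)) =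
      ENNReal.ofReal 2 * ∫⁻ z in Set.Ioo (0:ℝ) (1/2), ENNReal.ofReal ((1 - c z) * z ^ (1-2*s)) := by
    rw [← lintegral_const_mul' _ _ ENNReal.ofReal_ne_top]
    refine setLIntegral_congr_fun measurableSet_Ioo fun z hz => ?_
    rw [← ENNReal.ofReal_mul zero_le_two, norm_sub_sq_of_unit (harc _) (harc _), abs_of_pos hz.1,
      show 1 - 2*s = -(2*s-1) by ring, Real.rpow_neg hz.1.le, ← mul_assoc, div_eq_mul_inv]
  have hnn : ∀ z ∈ Set.Ioo (0:ℝ) (1/2), 0 ≤ (1 - c z) * z ^ (1-2*s) := fun z hz =>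
    mul_nonneg (sub_nonneg.2 (hc1 z)) (Real.rpow_nonneg hz.1.le _)
  have hnn' : 0 ≤ᵐ[volume.restrict (Set.Ioo (0:ℝ) (1/2))]
      fun z => (1 - c z) * z ^ (1-2*s) := by
    filter_upwards [ae_restrict_mem measurableSet_Ioo] with z hz using hnn z hz
  have hmeas : AEStronglyMeasurable (fun z => (1 - c z) * z ^ (1-2*s))
      (volume.restrict (Set.Ioo (0:ℝ) (1/2))) := by
    refine ContinuousOn.aestronglyMeasurable ?_ measurableSet_Ioo
    exact (continuous_const.sub hc).continuousOn.mul fun z hz =>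
      (Real.continuousAt_rpow_const z _ (Or.inl hz.1.ne')).continuousWithinAt
  have hCp : 0 < C ^ (2*s+1) := Real.rpow_pos_of_pos hC0 _
  by_cases hI : IntegrableOn (fun z => (1 - c z) * z ^ (1-2*s)) (Set.Ioo (0:ℝ) (1/2))
  · have key := hardy_core hs hM (by norm_num : (0:ℝ) < 1/2) hc hP hG hP0 hG0 hc1 hcg hI
    calc _ ≤ ∫⁻ w in Set.Ioo (0:ℝ) (1/2), ENNReal.ofReal (C ^ (2*s+1) / s) * ENNReal.ofReal
          (s * (min 1 (1/4 + 13/5 * (1 - P w / w)) * (G w ^ 2 * w ^ (-(2*s+1))))) := by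
          refine setLIntegral_mono' measurableSet_Ioo fun w hw => ?_
          rw [← ENNReal.ofReal_mul (by positivity)]
          apply ENNReal.ofReal_le_ofReal
          have hw0 := hw.1
          have hPr : P w ≤ ‖γ (x + w) - γ x‖ := by
            have := real_inner_le_norm (γ (x + w) - γ x) (γ' x)
            rwa [harc, mul_one] at this
          have hPw : P w ≤ w := by
            have := norm_primitive_le (M := 1) (g := fun _ => 0) (G := fun _ => 0) zero_le_one
              hw0.le hP (fun t => hasDerivAt_const _ _) hP0 rfl fun t => by
                have := abs_real_inner_le_norm (γ' (x + t)) (γ' x)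
                rw [harc, harc, mul_one] at this
                have := (sq_le_one_iff_abs_le_one _).2 this
                simpa [c] using this
            exact (le_abs_self _).trans (abs_le_of_sq_le_sq (by linarith) hw0.le)
          have hb := inv_rpow_le_mul_min (Y := 1 - P w / w) hs hC hC0 hw0 (hbil x w hw0 hw.2.le)
            (by rw [sub_sub_cancel, mul_div_cancel₀ _ hw0.ne']; exact hPr)
            (by rw [sub_nonneg, div_le_one hw0]; exact hPw)
          calc _ ≤ G w ^ 2 * (C ^ (2*s+1) *
                (min 1 (1/4 + 13/5 * (1 - P w / w)) * w ^ (-(2*s+1)))) :=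
                mul_le_mul_of_nonneg_left hb (sq_nonneg _)
            _ = _ := by
                have : s ≠ 0 := by linarith
                generalize min 1 (1/4 + 13/5 * (1 - P w / w)) = θ
                field_simp
      _ ≤ ENNReal.ofReal (C ^ (2*s+1) / s) *
          ENNReal.ofReal (M^2 * ∫ t in Set.Ioo (0:ℝ) (1/2), (1 - c t) * t ^ (1-2*s)) := by
          rw [lintegral_const_mul' _ _ ENNReal.ofReal_ne_top]
          gcongr
      _ = _ := by
          rw [hR, ← ofReal_integral_eq_lintegral_ofReal hI hnn',
            ← ENNReal.ofReal_mul (by positivity), ← ENNReal.ofReal_mul zero_le_two,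
            ← ENNReal.ofReal_mul (by positivity)]
          congr 1
          field_simp
  · have htop : ∫⁻ z in Set.Ioo (0:ℝ) (1/2), ENNReal.ofReal ((1 - c z) * z ^ (1-2*s)) = ⊤ := by
      by_contra hne
      exact hI ((lintegral_ofReal_ne_top_iff_integrable hmeas hnn').1 hne)
    rcases hM.eq_or_lt with rfl | hMp
    · have hGz : ∀ w ∈ Set.Ioo (0:ℝ) (1/2), G w = 0 := fun w hw => by
        have := norm_primitive_le le_rfl hw.1.le hP hG hP0 hG0 hcg
        nlinarith [sq_nonneg (G w)]
      rw [setLIntegral_congr_fun (g := fun _ => 0) measurableSet_Ioo fun w hw => by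
        simp [show ⟪h (x + w) - h x, γ' x⟫ = 0 from hGz w hw]]
      simp
    · rw [hR, htop, ENNReal.mul_top (by simp), ENNReal.mul_top]
      · exact le_top
      · have : 0 < s := by linarith
        rw [Ne, ENNReal.ofReal_eq_zero, not_le]
        positivity

/-- A closed unit-speed curve of period `1` has bi-Lipschitz constant at least `√2`. -/
lemma two_le_sq_of_closed {E : Type*} [NormedAddCommGroup E] [InnerProductSpace ℝ E]
    {C : ℝ} {γ γ' : ℝ → E} (hC0 : 0 < C) (hγd : ∀ x, HasDerivAt γ (γ' x) x)
    (hγper : ∀ x, γ (x + 1) = γ x) (harc : ∀ x, ‖γ' x‖ = 1)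
    (hbil : ∀ x, 1 / 2 / C ≤ ‖γ (x + 1/2) - γ x‖) : 2 ≤ C^2 := by
  set d : ℝ → E := fun t => γ (t + 1/2) - γ t
  have hdd : ∀ t, HasDerivAt d (γ' (t + 1/2) - γ' t) t := fun t =>
    ((hγd (t + 1/2)).comp_add_const t (1/2)).sub (hγd t)
  have hlip : ∀ a b : ℝ, a ≤ b → ‖d b - d a‖ ≤ 2 * (b - a) := fun a b hab =>
    norm_image_sub_le_of_norm_deriv_le_segment' (fun t _ => (hdd t).hasDerivWithinAt)
      (fun t _ => (norm_sub_le _ _).trans (by rw [harc, harc]; norm_num)) b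
      (Set.right_mem_Icc.2 hab)
  have hanti : d (1/2) = - d 0 := by
    have := hγper 0
    rw [zero_add] at this
    simp only [d]; norm_num
    rw [this]
  have hcont : Continuous fun t => ⟪d t, d 0⟫ :=
    (continuous_iff_continuousAt.2 fun t => (hdd t).continuousAt).inner continuous_const
  obtain ⟨t, ht, hzero⟩ : ∃ t ∈ Set.Icc (0:ℝ) (1/2), ⟪d t, d 0⟫ = 0 := by
    have := intermediate_value_Icc' (by norm_num : (0:ℝ) ≤ 1/2) hcont.continuousOn
    refine this ⟨?_, real_inner_self_nonneg⟩
    simp only [hanti, inner_neg_left]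
    exact neg_nonpos.2 real_inner_self_nonneg
  have hm : ∀ t, (1/2/C)^2 ≤ ‖d t‖^2 := fun t => by gcongr; exact hbil t
  have h1 : ‖d t - d 0‖^2 = ‖d t‖^2 + ‖d 0‖^2 := by rw [norm_sub_sq_real, hzero]; ring
  have h2 : ‖d (1/2) - d t‖^2 = ‖d t‖^2 + ‖d 0‖^2 := by
    rw [hanti, norm_sub_sq_real, inner_neg_left, norm_neg, real_inner_comm, hzero]; ring
  have h3 : ‖d t - d 0‖^2 ≤ (2 * (t - 0))^2 := by gcongr; exact hlip 0 t ht.1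
  have h4 : ‖d (1/2) - d t‖^2 ≤ (2 * (1/2 - t))^2 := by gcongr; exact hlip t _ ht.2
  have h5 : (1/2/C)^2 * C^2 = 1/4 := by field_simp; norm_num
  have h6 : 2 * (1/2/C)^2 ≤ 1/4 := by
    rcases le_total t (1/4) with h | h <;> nlinarith [hm t, hm 0, ht.1, ht.2]
  nlinarith [mul_le_mul_of_nonneg_right h6 (sq_nonneg C)]

lemma setLIntegral_Ioo_symm {b : ℝ} (f : ℝ → ℝ≥0∞) (hb : 0 < b) :
    ∫⁻ w in Set.Ioo (-b) b, f w =
      (∫⁻ w in Set.Ioo 0 b, f w) + ∫⁻ w in Set.Ioo 0 b, f (-w) := by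
  have h1 : ∫⁻ w in Set.Ioo 0 b, f (-w) = ∫⁻ w in Set.Ioo (-b) 0, f w := by
    rw [← (Measure.measurePreserving_neg (volume : Measure ℝ)).setLIntegral_comp_preimage_emb
      (MeasurableEquiv.neg ℝ).measurableEmbedding f (Set.Ioo (-b) 0)]
    simp
  rw [h1, ← Set.Ioc_union_Ioo_eq_Ioo (neg_neg_of_pos hb).le hb,
    lintegral_union measurableSet_Ioo (Set.disjoint_left.2 fun w hw hw' => hw.2.not_gt hw'.1),
    add_comm, setLIntegral_congr (Ioo_ae_eq_Ioc (a := -b) (b := 0))]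

lemma inner_Om_sq_mul_dens {n : ℕ} {s : ℝ} {γ γ' h h' : ℝ → EuclideanSpace ℝ (Fin n)}
    (harc : ∀ x, ‖γ' x‖ = 1) (horth : ∀ x, ⟪γ' x, h' x⟫ = 0) {x w : ℝ}
    (hr : 0 < ‖γ (x + w) - γ x‖) :
    ⟪Om s γ γ' h h' x w, γ' x⟫ ^ 2 * dens γ γ' x w =
      ⟪h (x + w) - h x, γ' x⟫^2 * (‖γ (x + w) - γ x‖ ^ (2*s+1))⁻¹ := by
  have e : ‖γ (x + w) - γ x‖ ^ (2*s+1) =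
      (‖γ (x + w) - γ x‖ ^ s)^2 * ‖γ (x + w) - γ x‖ := by
    rw [Real.rpow_add_one hr.ne', ← Real.rpow_mul_natCast hr.le]
    congr 2; push_cast; ring
  have hp := (Real.rpow_pos_of_pos hr s).ne'
  have e2 : ⟪Lg γ γ' h h' x w, γ' x⟫ = ⟪h (x + w) - h x, γ' x⟫ := by
    have hx : ⟪h' x, γ' x⟫ = 0 := by rw [real_inner_comm, horth]
    rw [Lg, Dg, Dg, inner_sub_left, real_inner_smul_left, real_inner_smul_left,
      real_inner_smul_left, hx, mul_zero,
      mul_zero, sub_zero]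
  rw [e, Om, dens, real_inner_smul_left, e2, harc, harc]
  field_simp

/-- Tangential-projection estimate:
`∬ |⟨Ω^s_γ h, γ'(x)⟩|² dμ_γ
  ≤ C^{2s+1} (1/(2s)) ‖h'‖_∞² ∬ |γ'(x+z) − γ'(x)|²/|z|^{2s−1} dz dx`. -/
theorem stmt5 {n : ℕ} (hn : 2 ≤ n) (s : ℝ) (hs : s ∈ Set.Ioo (3/2 : ℝ) 2)
    (C : ℝ) (hC : 1 ≤ C)
    (γ γ' h h' : ℝ → EuclideanSpace ℝ (Fin n))
    (hγd : ∀ x, HasDerivAt γ (γ' x) x) (hγc : Continuous γ')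
    (hγper : ∀ x, γ (x + 1) = γ x)
    (harc : ∀ x, ‖γ' x‖ = 1)
    (hinj : Set.InjOn γ (Set.Ico (0:ℝ) 1))
    (hbil : ∀ x w : ℝ, |w| ≤ 1/2 → |w| / C ≤ ‖γ (x + w) - γ x‖)
    (hhd : ∀ x, HasDerivAt h (h' x) x) (hhc : Continuous h')
    (hhper : ∀ x, h (x + 1) = h x)
    (horth : ∀ x, ⟪γ' x, h' x⟫ = 0) :
    (∫⁻ x in Set.Icc (0:ℝ) 1, ∫⁻ w in Set.Ioo (-(1:ℝ)/2) (1/2),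
        ENNReal.ofReal (⟪Om s γ γ' h h' x w, γ' x⟫ ^ 2 * dens γ γ' x w))
      ≤ ENNReal.ofReal (C ^ (2*s+1) * (1/(2*s)) * (⨆ x : ℝ, ‖h' x‖) ^ 2) *
        ∫⁻ x in Set.Icc (0:ℝ) 1, ∫⁻ z in Set.Ioo (-(1:ℝ)/2) (1/2),
          ENNReal.ofReal (‖γ' (x + z) - γ' x‖ ^ 2 / |z| ^ (2*s-1)) := by
  have hC0 : 0 < C := by linarith
  have hs1 := hs.1
  have hC2 : 2 ≤ C^2 := two_le_sq_of_closed hC0 hγd hγper harc fun x => by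
    have := hbil x (1/2) (by norm_num)
    rwa [abs_of_pos (by norm_num : (0:ℝ) < 1/2)] at this
  have hper : Function.Periodic h' 1 := fun x => by
    have h1 := (hhd (x + 1)).comp_add_const x 1
    simp only [hhper] at h1
    exact h1.unique (hhd x)
  have hbdd : BddAbove (Set.range fun x => ‖h' x‖) := by
    have hp : Function.Periodic (fun x => ‖h' x‖) 1 := fun x => by simp only [hper x]
    exact (hp.compact_of_continuous one_ne_zero hhc.norm).bddAbove
  set M := ⨆ x : ℝ, ‖h' x‖
  have hhM : ∀ x, ‖h' x‖ ≤ M := fun x => le_ciSup hbdd x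
  have hr : ∀ x w : ℝ, w ≠ 0 → |w| ≤ 1/2 → 0 < ‖γ (x + w) - γ x‖ := fun x w hw hw2 =>
    (by positivity : 0 < |w| / C).trans_le (hbil x w hw2)
  rw [← lintegral_const_mul' _ _ ENNReal.ofReal_ne_top]
  refine lintegral_mono fun x => ?_
  simp only
  rw [neg_div, setLIntegral_Ioo_symm _ one_half_pos, setLIntegral_Ioo_symm _ one_half_pos, mul_add]
  gcongr ?_ + ?_
  · refine le_of_eq_of_le (setLIntegral_congr_fun measurableSet_Ioo fun w hw => ?_)
      (tangential_halfline hs1 hC0 hC2 hγd hγc harc (fun x w hw hw2 => ?_) hhd horth hhM x)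
    · rw [inner_Om_sq_mul_dens harc horth
        (hr x w hw.1.ne' (by rw [abs_of_pos hw.1]; exact hw.2.le))]
    · have := hbil x w (by rwa [abs_of_pos hw])
      rwa [abs_of_pos hw] at this
  · have hrev : ∀ {k k' : ℝ → EuclideanSpace ℝ (Fin n)}, (∀ x, HasDerivAt k (k' x) x) →
        ∀ x, HasDerivAt (fun t => k (-t)) (-k' (-x)) x := fun hk x => by
      simpa [Function.comp_def] using (hk (-x)).scomp x (hasDerivAt_neg x)
    have key := tangential_halfline (γ := fun t => γ (-t)) (γ' := fun t => -γ' (-t))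
      (h := fun t => h (-t)) (h' := fun t => -h' (-t)) (M := M) hs1 hC0 hC2 (hrev hγd)
      (hγc.comp continuous_neg).neg (fun x => by rw [norm_neg, harc])
      (fun x w hw hw2 => by
        have := hbil (-x) (-w) (by rwa [abs_neg, abs_of_pos hw])
        rw [abs_neg, abs_of_pos hw] at this
        rwa [neg_add])
      (hrev hhd) (fun x => by rw [inner_neg_neg, horth]) (fun x => by rw [norm_neg]; exact hhM _)
      (-x)
    refine le_of_eq_of_le (setLIntegral_congr_fun measurableSet_Ioo fun w hw => ?_)
      (key.trans_eq ?_)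
    · rw [inner_Om_sq_mul_dens harc horth
        (hr x (-w) (neg_ne_zero.2 hw.1.ne') (by rw [abs_neg, abs_of_pos hw.1]; exact hw.2.le))]
      simp [add_comm]
    · congr 1
      refine setLIntegral_congr_fun measurableSet_Ioo fun w _ => ?_
      have e : ∀ a b : EuclideanSpace ℝ (Fin n), ‖-a - -b‖ = ‖a - b‖ := fun a b => by
        rw [← norm_neg]; congr 1; abel
      simp only [neg_add, neg_neg, abs_neg, e]
end

section
/- Let s ∈ (3/2,2), and let γ : ℝ → ℝⁿ be a smooth 1-periodic curve with γ'(x) ≠ 0 for all x, injective on [0,1). Let h : ℝ → ℝⁿ be smooth and 1-periodic. Then the map ε ↦ TP(γ + εh) is differentiable at ε = 0 and d/dε|_{ε=0} TP(γ+εh) = 2 ∫₀¹∫_{−1/2}^{1/2} ⟨Ω^s_γ γ, Ω^s_γ h⟩ dμ_γ − (2s+1) ∫₀¹∫_{−1/2}^{1/2} |Ω^s_γ γ|² ⟨Δ_w γ(x), Δ_w h(x)⟩ / |Δ_w γ(x)|² dμ_γ + ∫₀¹∫_{−1/2}^{1/2} |Ω^s_γ γ|² ( ⟨D_γ γ(x),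 D_γ h(x)⟩ + ⟨D_γ γ(x+w), D_γ h(x+w)⟩ ) dμ_γ. -/
open MeasureTheory
open scoped RealInnerProductSpace ENNReal

/-- The tangent-point energy as a real number: `TP(γ) = ∬ |Ω^s_γ γ|² dμ_γ`. -/
noncomputable def TPr {n : ℕ} (s : ℝ) (γ γ' : ℝ → EuclideanSpace ℝ (Fin n)) : ℝ :=
  ∫ x in Set.Icc (0:ℝ) 1, ∫ w in Set.Ioo (-(1:ℝ)/2) (1/2),
    ‖Om s γ γ' γ γ' x w‖ ^ 2 * dens γ γ' x w

/-- The integrand of `B¹_γ(γ,h)`. -/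
noncomputable def polarDensity {n : ℕ} (s : ℝ) (γ γ' h h' : ℝ → EuclideanSpace ℝ (Fin n))
    (x w : ℝ) : ℝ :=
  ⟪Om s γ γ' γ γ' x w, Om s γ γ' h h' x w⟫ * dens γ γ' x w

/-- The integrand of `B²_γ(γ,h)`. -/
noncomputable def chordDensity {n : ℕ} (s : ℝ) (γ γ' h : ℝ → EuclideanSpace ℝ (Fin n))
    (x w : ℝ) : ℝ :=
  ‖Om s γ γ' γ γ' x w‖ ^ 2 *
    (⟪γ (x + w) - γ x, h (x + w) - h x⟫ / ‖γ (x + w) - γ x‖ ^ 2) * dens γ γ' x w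

/-- The integrand of `B³_γ(γ,h)`. -/
noncomputable def speedDensity {n : ℕ} (s : ℝ) (γ γ' h' : ℝ → EuclideanSpace ℝ (Fin n))
    (x w : ℝ) : ℝ :=
  ‖Om s γ γ' γ γ' x w‖ ^ 2 *
    (⟪Dg γ' γ' x, Dg γ' h' x⟫ + ⟪Dg γ' γ' (x + w), Dg γ' h' (x + w)⟫) * dens γ γ' x w

/-- The integrand of the first variation of the tangent-point energy. -/
noncomputable def variationDensity {n : ℕ} (s : ℝ) (γ γ' h h' : ℝ → EuclideanSpace ℝ (Fin n))
    (x w : ℝ) : ℝ :=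
  2 * polarDensity s γ γ' h h' x w - (2 * s + 1) * chordDensity s γ γ' h x w
    + speedDensity s γ γ' h' x w

section Pointwise

variable {E : Type*} [NormedAddCommGroup E] [InnerProductSpace ℝ E]

theorem inner_sub_projection_sub_projection {p u d e : E} (hp : p ≠ 0) :
    ⟪d - ⟪‖p‖⁻¹ • p, d⟫ • ‖p‖⁻¹ • p, e - ⟪‖p‖⁻¹ • p, d⟫ • ‖p‖⁻¹ • u⟫ =
      ⟪d, e⟫ - ⟪p, d⟫ * (⟪u, d⟫ + ⟪p, e⟫) / ‖p‖ ^ 2 + ⟪p, d⟫ ^ 2 * ⟪p, u⟫ / (‖p‖ ^ 2) ^ 2 := by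
  have h0 : ‖p‖ ≠ 0 := norm_ne_zero_iff.2 hp
  simp only [inner_sub_left, inner_sub_right, real_inner_smul_left, real_inner_smul_right]
  rw [real_inner_comm d u]
  field_simp
  ring

theorem norm_sub_projection_sq (p d : E) :
    ‖d - ⟪‖p‖⁻¹ • p, d⟫ • ‖p‖⁻¹ • p‖ ^ 2 = ‖d‖ ^ 2 - ⟪p, d⟫ ^ 2 / ‖p‖ ^ 2 := by
  rcases eq_or_ne p 0 with rfl | hp
  · simp
  have h0 : ‖p‖ ≠ 0 := norm_ne_zero_iff.2 hp
  rw [← real_inner_self_eq_norm_sq, inner_sub_projection_sub_projection hp,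
    real_inner_self_eq_norm_sq, real_inner_self_eq_norm_sq]
  rw [real_inner_comm d p]
  field_simp
  ring

theorem inv_rpow_sq_div {N : ℝ} (hN : 0 ≤ N) {s : ℝ} (hs : 0 < s) :
    ((N ^ s)⁻¹) ^ 2 / N = (N ^ 2) ^ (-(s + 1 / 2)) := by
  rcases hN.eq_or_lt with rfl | hN
  · rw [zero_pow two_ne_zero, div_zero, Real.zero_rpow (by linarith)]
  rw [← Real.rpow_natCast, ← Real.rpow_natCast, ← Real.rpow_mul hN.le, ← Real.rpow_neg hN.le,
    ← Real.rpow_mul hN.le, div_eq_mul_inv, ← Real.rpow_neg_one N, ← Real.rpow_add hN]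
  congr 1
  push_cast
  ring

/-- The derivative of the tangent-point integrand, as a function of the two tangent vectors and of
the chord. -/
theorem hasDerivAt_tangentPoint_integrand {s : ℝ} {P Q D : ℝ → E} {u v e : E} {t : ℝ}
    (hP : HasDerivAt P u t) (hQ : HasDerivAt Q v t) (hD : HasDerivAt D e t)
    (hs : 0 < s) (hP0 : P t ≠ 0) (hQ0 : Q t ≠ 0) (hD0 : D t ≠ 0) :
    HasDerivAt
      (fun τ => ‖(‖D τ‖ ^ s)⁻¹ • (D τ - ⟪‖P τ‖⁻¹ • P τ, D τ⟫ • ‖P τ‖⁻¹ • P τ)‖ ^ 2 *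
        (‖P τ‖ * ‖Q τ‖ / ‖D τ‖))
      (2 * (⟪(‖D t‖ ^ s)⁻¹ • (D t - ⟪‖P t‖⁻¹ • P t, D t⟫ • ‖P t‖⁻¹ • P t),
            (‖D t‖ ^ s)⁻¹ • (e - ⟪‖P t‖⁻¹ • P t, D t⟫ • ‖P t‖⁻¹ • u)⟫ *
          (‖P t‖ * ‖Q t‖ / ‖D t‖))
        - (2 * s + 1) * (‖(‖D t‖ ^ s)⁻¹ • (D t - ⟪‖P t‖⁻¹ • P t, D t⟫ • ‖P t‖⁻¹ • P t)‖ ^ 2 *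
          (⟪D t, e⟫ / ‖D t‖ ^ 2) * (‖P t‖ * ‖Q t‖ / ‖D t‖))
        + ‖(‖D t‖ ^ s)⁻¹ • (D t - ⟪‖P t‖⁻¹ • P t, D t⟫ • ‖P t‖⁻¹ • P t)‖ ^ 2 *
          (⟪‖P t‖⁻¹ • P t, ‖P t‖⁻¹ • u⟫ + ⟪‖Q t‖⁻¹ • Q t, ‖Q t‖⁻¹ • v⟫) *
          (‖P t‖ * ‖Q t‖ / ‖D t‖)) t := by
  have hP1 : 0 < ‖P t‖ := norm_pos_iff.2 hP0
  have hQ1 : 0 < ‖Q t‖ := norm_pos_iff.2 hQ0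
  have hD1 : 0 < ‖D t‖ := norm_pos_iff.2 hD0
  have key := (((hD.norm_sq).sub (((hP.inner ℝ hD).pow 2).div hP.norm_sq (by positivity))).mul
    (((hP.norm_sq).sqrt (by positivity)).mul ((hQ.norm_sq).sqrt (by positivity)))).mul
      ((hD.norm_sq).rpow_const (p := -(s + 1 / 2)) (Or.inl (by positivity)))
  have hfun : (fun τ => ‖(‖D τ‖ ^ s)⁻¹ • (D τ - ⟪‖P τ‖⁻¹ • P τ, D τ⟫ • ‖P τ‖⁻¹ • P τ)‖ ^ 2 *
        (‖P τ‖ * ‖Q τ‖ / ‖D τ‖)) = fun τ => (‖D τ‖ ^ 2 - ⟪P τ, D τ⟫ ^ 2 / ‖P τ‖ ^ 2) *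
        (√(‖P τ‖ ^ 2) * √(‖Q τ‖ ^ 2)) * (‖D τ‖ ^ 2) ^ (-(s + 1 / 2)) := by
    funext τ
    rw [norm_smul, mul_pow, norm_sub_projection_sq, Real.sqrt_sq (norm_nonneg _),
      Real.sqrt_sq (norm_nonneg _), ← inv_rpow_sq_div (norm_nonneg _) hs, Real.norm_eq_abs,
      sq_abs]
    ring
  rw [hfun]
  refine key.congr_deriv ?_
  simp only [Pi.mul_apply, Pi.sub_apply, Pi.div_apply, Pi.pow_apply]
  rw [Real.sqrt_sq (norm_nonneg _), Real.sqrt_sq (norm_nonneg _), Real.rpow_sub_one (by positivity),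
    ← inv_rpow_sq_div (norm_nonneg _) hs, real_inner_smul_left _ _ (‖D t‖ ^ s)⁻¹,
    real_inner_smul_right _ _ (‖D t‖ ^ s)⁻¹, inner_sub_projection_sub_projection hP0, norm_smul,
    mul_pow, norm_sub_projection_sq, Real.norm_eq_abs, sq_abs]
  simp only [real_inner_smul_left, real_inner_smul_right]
  generalize (‖D t‖ ^ s)⁻¹ = a
  field_simp
  ring

end Pointwise

theorem hasDerivAt_energyDensity_add_smul {n : ℕ} {s : ℝ} (hs : 0 < s)
    (γ γ' h h' : ℝ → EuclideanSpace ℝ (Fin n)) {x w t : ℝ}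
    (hx : γ' x + t • h' x ≠ 0) (hxw : γ' (x + w) + t • h' (x + w) ≠ 0)
    (hd : (γ (x + w) + t • h (x + w)) - (γ x + t • h x) ≠ 0) :
    HasDerivAt
      (fun ε : ℝ => ‖Om s (fun x => γ x + ε • h x) (fun x => γ' x + ε • h' x)
          (fun x => γ x + ε • h x) (fun x => γ' x + ε • h' x) x w‖ ^ 2 *
        dens (fun x => γ x + ε • h x) (fun x => γ' x + ε • h' x) x w)
      (variationDensity s (fun x => γ x + t • h x) (fun x => γ' x + t • h' x) h h' x w) t := by
  have aux (a b : EuclideanSpace ℝ (Fin n)) : HasDerivAt (fun ε : ℝ => a + ε • b) b t := by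
    simpa using ((hasDerivAt_id t).smul_const b).const_add a
  exact hasDerivAt_tangentPoint_integrand (aux (γ' x) (h' x)) (aux (γ' (x + w)) (h' (x + w)))
    ((aux (γ (x + w)) (h (x + w))).sub (aux (γ x) (h x))) hs hx hxw hd

/-- Bounds, linear and quadratic in `w`, for the increments of `h` at `x`. -/
structure UpperBounds {n : ℕ} (M : ℝ) (h h' : ℝ → EuclideanSpace ℝ (Fin n)) (x w : ℝ) : Prop where
  left : ‖h' x‖ ≤ M
  right : ‖h' (x + w)‖ ≤ M
  increment : ‖h (x + w) - h x‖ ≤ M * |w|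
  remainder : ‖h (x + w) - h x - w • h' x‖ ≤ M * w ^ 2

/-- Lower bounds for the speed of `γ` and for its chords starting at `x`. -/
structure LowerBounds {n : ℕ} (c : ℝ) (γ γ' : ℝ → EuclideanSpace ℝ (Fin n)) (x w : ℝ) : Prop where
  left : c ≤ ‖γ' x‖
  right : c ≤ ‖γ' (x + w)‖
  chord : c * |w| ≤ ‖γ (x + w) - γ x‖

theorem UpperBounds.add_smul {n : ℕ} {M t x w : ℝ} {γ γ' h h' : ℝ → EuclideanSpace ℝ (Fin n)}
    (hγ : UpperBounds M γ γ' x w) (hh : UpperBounds M h h' x w) (ht : |t| ≤ 1) :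
    UpperBounds (2 * M) (fun x => γ x + t • h x) (fun x => γ' x + t • h' x) x w := by
  have aux {a b : EuclideanSpace ℝ (Fin n)} {K : ℝ} (ha : ‖a‖ ≤ K) (hb : ‖b‖ ≤ K) :
      ‖a + t • b‖ ≤ 2 * K := by
    refine (norm_add_le _ _).trans ?_
    rw [norm_smul, Real.norm_eq_abs]
    nlinarith [mul_le_of_le_one_left (norm_nonneg b) ht]
  refine ⟨aux hγ.left hh.left, aux hγ.right hh.right, ?_, ?_⟩
  · rw [mul_assoc]
    convert aux hγ.increment hh.increment using 2
    module
  · rw [mul_assoc]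
    convert aux hγ.remainder hh.remainder using 2
    module

theorem LowerBounds.add_smul {n : ℕ} {c M t x w : ℝ} {γ γ' h h' : ℝ → EuclideanSpace ℝ (Fin n)}
    (hγ : LowerBounds c γ γ' x w) (hh : UpperBounds M h h' x w) (ht : |t| * M ≤ c / 2) :
    LowerBounds (c / 2) (fun x => γ x + t • h x) (fun x => γ' x + t • h' x) x w := by
  have aux {a b : EuclideanSpace ℝ (Fin n)} {K : ℝ} (hK : 0 ≤ K) (ha : c * K ≤ ‖a‖)
      (hb : ‖b‖ ≤ M * K) : c / 2 * K ≤ ‖a + t • b‖ := by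
    have h1 : ‖a‖ ≤ ‖a + t • b‖ + ‖t • b‖ := norm_le_add_norm_add a (t • b)
    rw [norm_smul, Real.norm_eq_abs] at h1
    nlinarith [mul_le_mul_of_nonneg_left hb (abs_nonneg t), mul_le_mul_of_nonneg_right ht hK]
  refine ⟨?_, ?_, ?_⟩
  · simpa using aux zero_le_one (by simpa using hγ.left) (by simpa using hh.left)
  · simpa using aux zero_le_one (by simpa using hγ.right) (by simpa using hh.right)
  · convert aux (abs_nonneg w) hγ.chord hh.increment using 2
    module

theorem norm_Lg_le {n : ℕ} {c M x w : ℝ} {γ γ' h h' : ℝ → EuclideanSpace ℝ (Fin n)}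
    (hc : 0 < c) (hl : LowerBounds c γ γ' x w) (hγ : UpperBounds M γ γ' x w)
    (hh : UpperBounds M h h' x w) : ‖Lg γ γ' h h' x w‖ ≤ (M + M * M / c) * w ^ 2 := by
  have hp : 0 < ‖γ' x‖ := hc.trans_le hl.left
  have hM : 0 ≤ M := (norm_nonneg _).trans hh.left
  have hsplit : Lg γ γ' h h' x w = (h (x + w) - h x - w • h' x) -
      (⟪γ' x, γ (x + w) - γ x - w • γ' x⟫ * ‖γ' x‖⁻¹ * ‖γ' x‖⁻¹) • h' x := by
    have : ⟪γ' x, γ (x + w) - γ x - w • γ' x⟫ * ‖γ' x‖⁻¹ * ‖γ' x‖⁻¹ =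
        ⟪γ' x, γ (x + w) - γ x⟫ * ‖γ' x‖⁻¹ * ‖γ' x‖⁻¹ - w := by
      rw [inner_sub_right _ _ (w • γ' x), real_inner_smul_right, real_inner_self_eq_norm_sq]
      field_simp
    rw [this]
    simp only [Lg, Dg, real_inner_smul_left]
    module
  have hcoef : |⟪γ' x, γ (x + w) - γ x - w • γ' x⟫ * ‖γ' x‖⁻¹ * ‖γ' x‖⁻¹| ≤ M * w ^ 2 / c := by
    rw [abs_mul, abs_mul, abs_of_pos (inv_pos.2 hp), div_eq_mul_inv]
    have h1 : |⟪γ' x, γ (x + w) - γ x - w • γ' x⟫| * ‖γ' x‖⁻¹ ≤ M * w ^ 2 := by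
      rw [← div_eq_mul_inv, div_le_iff₀ hp, mul_comm]
      exact (abs_real_inner_le_norm _ _).trans
        (mul_le_mul_of_nonneg_left hγ.remainder (norm_nonneg _))
    exact mul_le_mul h1 (inv_anti₀ hc hl.left) (by positivity) (by positivity)
  rw [hsplit]
  refine (norm_sub_le _ _).trans ?_
  rw [norm_smul, Real.norm_eq_abs]
  have := mul_le_mul hcoef hh.left (norm_nonneg _) (by positivity)
  calc _ ≤ M * w ^ 2 + M * w ^ 2 / c * M := add_le_add hh.remainder this
    _ = _ := by ring

/-- A singular majorant, of order `|w| ^ (3 - 2 * s)`, of the densities. -/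
noncomputable def majorant (s c M w : ℝ) : ℝ :=
  (((c * |w|) ^ s)⁻¹ * ((M + M * M / c) * w ^ 2)) ^ 2 * (M * M / (c * |w|))

theorem norm_Om_le {n : ℕ} {s c M x w : ℝ} {γ γ' h h' : ℝ → EuclideanSpace ℝ (Fin n)}
    (hs : 0 < s) (hc : 0 < c) (hw : w ≠ 0) (hl : LowerBounds c γ γ' x w)
    (hγ : UpperBounds M γ γ' x w) (hh : UpperBounds M h h' x w) :
    ‖Om s γ γ' h h' x w‖ ≤ ((c * |w|) ^ s)⁻¹ * ((M + M * M / c) * w ^ 2) := by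
  have hw' : 0 < c * |w| := mul_pos hc (abs_pos.2 hw)
  have hd : 0 < ‖γ (x + w) - γ x‖ := hw'.trans_le hl.chord
  rw [Om, norm_smul, Real.norm_eq_abs, abs_of_nonneg (by positivity)]
  exact mul_le_mul (inv_anti₀ (by positivity) (Real.rpow_le_rpow hw'.le hl.chord hs.le))
    (norm_Lg_le hc hl hγ hh) (norm_nonneg _) (by positivity)

theorem dens_nonneg {n : ℕ} (γ γ' : ℝ → EuclideanSpace ℝ (Fin n)) (x w : ℝ) :
    0 ≤ dens γ γ' x w := by
  unfold dens
  positivity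

theorem dens_le {n : ℕ} {c M x w : ℝ} {γ γ' : ℝ → EuclideanSpace ℝ (Fin n)}
    (hc : 0 < c) (hw : w ≠ 0) (hl : LowerBounds c γ γ' x w) (hγ : UpperBounds M γ γ' x w) :
    dens γ γ' x w ≤ M * M / (c * |w|) := by
  have hM : 0 ≤ M := (norm_nonneg _).trans hγ.left
  exact div_le_div₀ (by positivity) (mul_le_mul hγ.left hγ.right (norm_nonneg _) hM)
    (mul_pos hc (abs_pos.2 hw)) hl.chord

theorem abs_polarDensity_le {n : ℕ} {s c M x w : ℝ} {γ γ' h h' : ℝ → EuclideanSpace ℝ (Fin n)}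
    (hs : 0 < s) (hc : 0 < c) (hw : w ≠ 0) (hl : LowerBounds c γ γ' x w)
    (hγ : UpperBounds M γ γ' x w) (hh : UpperBounds M h h' x w) :
    |polarDensity s γ γ' h h' x w| ≤ majorant s c M w := by
  have hM : 0 ≤ M := (norm_nonneg _).trans hγ.left
  rw [polarDensity, abs_mul, abs_of_nonneg (dens_nonneg _ _ _ _), majorant, sq]
  refine mul_le_mul ((abs_real_inner_le_norm _ _).trans ?_) (dens_le hc hw hl hγ)
    (dens_nonneg _ _ _ _) (by positivity)
  exact mul_le_mul (norm_Om_le hs hc hw hl hγ hγ) (norm_Om_le hs hc hw hl hγ hh)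
    (norm_nonneg _) (by positivity)

theorem polarDensity_self {n : ℕ} (s : ℝ) (γ γ' : ℝ → EuclideanSpace ℝ (Fin n)) (x w : ℝ) :
    polarDensity s γ γ' γ γ' x w = ‖Om s γ γ' γ γ' x w‖ ^ 2 * dens γ γ' x w := by
  rw [polarDensity, real_inner_self_eq_norm_sq]

theorem abs_chordDensity_le {n : ℕ} {s c M x w : ℝ} {γ γ' h h' : ℝ → EuclideanSpace ℝ (Fin n)}
    (hs : 0 < s) (hc : 0 < c) (hw : w ≠ 0) (hl : LowerBounds c γ γ' x w)
    (hγ : UpperBounds M γ γ' x w) (hh : UpperBounds M h h' x w) :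
    |chordDensity s γ γ' h x w| ≤ M / c * majorant s c M w := by
  have hM : 0 ≤ M := (norm_nonneg _).trans hγ.left
  have hw' : 0 < |w| := abs_pos.2 hw
  have hd : 0 < ‖γ (x + w) - γ x‖ := (mul_pos hc hw').trans_le hl.chord
  have hq : |⟪γ (x + w) - γ x, h (x + w) - h x⟫ / ‖γ (x + w) - γ x‖ ^ 2| ≤ M / c := by
    rw [abs_div, abs_of_pos (a := ‖γ (x + w) - γ x‖ ^ 2) (by positivity),
      div_le_div_iff₀ (by positivity) hc]
    calc |⟪γ (x + w) - γ x, h (x + w) - h x⟫| * c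
        ≤ ‖γ (x + w) - γ x‖ * (M * |w|) * c := by
          gcongr
          exact (abs_real_inner_le_norm _ _).trans
            (mul_le_mul_of_nonneg_left hh.increment (norm_nonneg _))
      _ = M * (‖γ (x + w) - γ x‖ * (c * |w|)) := by ring
      _ ≤ M * (‖γ (x + w) - γ x‖ * ‖γ (x + w) - γ x‖) := by gcongr; exact hl.chord
      _ = _ := by ring
  have hE := abs_polarDensity_le hs hc hw hl hγ hγ
  have : chordDensity s γ γ' h x w =
      ⟪γ (x + w) - γ x, h (x + w) - h x⟫ / ‖γ (x + w) - γ x‖ ^ 2 *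
        polarDensity s γ γ' γ γ' x w := by
    rw [polarDensity_self, chordDensity]
    ring
  rw [this, abs_mul]
  exact mul_le_mul hq hE (abs_nonneg _) (by positivity)

theorem abs_inner_Dg_le {n : ℕ} {c M y : ℝ} {γ' h' : ℝ → EuclideanSpace ℝ (Fin n)}
    (hc : 0 < c) (hl : c ≤ ‖γ' y‖) (hh : ‖h' y‖ ≤ M) :
    |⟪Dg γ' γ' y, Dg γ' h' y⟫| ≤ M / c := by
  have hp : 0 < ‖γ' y‖ := hc.trans_le hl
  refine (abs_real_inner_le_norm _ _).trans ?_
  rw [Dg, Dg, norm_smul, norm_smul, norm_inv, norm_norm, inv_mul_cancel₀ hp.ne', one_mul,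
    mul_comm, ← div_eq_mul_inv]
  exact div_le_div₀ ((norm_nonneg _).trans hh) hh hc hl

theorem abs_speedDensity_le {n : ℕ} {s c M x w : ℝ} {γ γ' h h' : ℝ → EuclideanSpace ℝ (Fin n)}
    (hs : 0 < s) (hc : 0 < c) (hw : w ≠ 0) (hl : LowerBounds c γ γ' x w)
    (hγ : UpperBounds M γ γ' x w) (hh : UpperBounds M h h' x w) :
    |speedDensity s γ γ' h' x w| ≤ 2 * (M / c) * majorant s c M w := by
  have hM : 0 ≤ M := (norm_nonneg _).trans hγ.left
  have hE := abs_polarDensity_le hs hc hw hl hγ hγ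
  have : speedDensity s γ γ' h' x w =
      (⟪Dg γ' γ' x, Dg γ' h' x⟫ + ⟪Dg γ' γ' (x + w), Dg γ' h' (x + w)⟫) *
        polarDensity s γ γ' γ γ' x w := by
    rw [polarDensity_self, speedDensity]
    ring
  rw [this, abs_mul]
  refine mul_le_mul ?_ hE (abs_nonneg _) (by positivity)
  rw [two_mul]
  exact (abs_add_le _ _).trans
    (add_le_add (abs_inner_Dg_le hc hl.left hh.left) (abs_inner_Dg_le hc hl.right hh.right))

theorem abs_variationDensity_le {n : ℕ} {s c M x w : ℝ}
    {γ γ' h h' : ℝ → EuclideanSpace ℝ (Fin n)}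
    (hs : 0 < s) (hc : 0 < c) (hw : w ≠ 0) (hl : LowerBounds c γ γ' x w)
    (hγ : UpperBounds M γ γ' x w) (hh : UpperBounds M h h' x w) :
    |variationDensity s γ γ' h h' x w| ≤
      (2 + (2 * s + 1) * (M / c) + 2 * (M / c)) * majorant s c M w := by
  have h1 := abs_polarDensity_le hs hc hw hl hγ hh
  have h2 := abs_chordDensity_le hs hc hw hl hγ hh
  have h3 := abs_speedDensity_le hs hc hw hl hγ hh
  have hs' : 0 < 2 * s + 1 := by linarith
  rw [abs_le] at *
  unfold variationDensity
  constructor <;> nlinarith [mul_le_mul_of_nonneg_left h2.1 hs'.le,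
    mul_le_mul_of_nonneg_left h2.2 hs'.le]

theorem abs_rpow_three_sub {s w : ℝ} (hs : 3 / 2 < s) :
    ((|w| ^ s)⁻¹ * w ^ 2) ^ 2 / |w| = |w| ^ (3 - 2 * s) := by
  rcases eq_or_ne w 0 with rfl | hw
  · rw [abs_zero, div_zero, Real.zero_rpow (by linarith)]
  have hw' : 0 < |w| := abs_pos.2 hw
  rw [Real.rpow_sub hw', two_mul, Real.rpow_add hw', ← sq_abs w,
    show (3 : ℝ) = ((3 : ℕ) : ℝ) by norm_num, Real.rpow_natCast]
  field_simp

theorem integrableOn_majorant {s c : ℝ} (hs : s ∈ Set.Ioo (3 / 2 : ℝ) 2) (hc : 0 < c) (M : ℝ) :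
    IntegrableOn (majorant s c M) (Set.Ioo (-(1 : ℝ) / 2) (1 / 2)) := by
  have h1 : IntervalIntegrable (fun w : ℝ => |w| ^ (3 - 2 * s)) volume (-(1 : ℝ) / 2) (1 / 2) := by
    refine intervalIntegrable_of_even (fun x => by rw [abs_neg]) fun x hx => ?_
    refine (intervalIntegral.intervalIntegrable_rpow' (r := 3 - 2 * s)
      (by linarith [hs.2])).congr fun y hy => ?_
    rw [Set.uIoc_of_le hx.le] at hy
    simp only [abs_of_pos hy.1]
  rw [intervalIntegrable_iff_integrableOn_Ioo_of_le (by norm_num)] at h1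
  refine IntegrableOn.congr_fun (h1.const_mul ((((c ^ s)⁻¹ * (M + M * M / c)) ^ 2) * (M * M / c)))
    (fun w _ => ?_) measurableSet_Ioo
  rw [← abs_rpow_three_sub hs.1, majorant, Real.mul_rpow hc.le (abs_nonneg w)]
  ring

theorem UpperBounds.mono {n : ℕ} {M N x w : ℝ} {h h' : ℝ → EuclideanSpace ℝ (Fin n)}
    (hh : UpperBounds M h h' x w) (hMN : M ≤ N) : UpperBounds N h h' x w :=
  ⟨hh.left.trans hMN, hh.right.trans hMN,
    hh.increment.trans (mul_le_mul_of_nonneg_right hMN (abs_nonneg w)),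
    hh.remainder.trans (mul_le_mul_of_nonneg_right hMN (sq_nonneg w))⟩

theorem contDiff_of_hasDerivAt {n : ℕ} {h h' : ℝ → EuclideanSpace ℝ (Fin n)}
    (hhd : ∀ x, HasDerivAt h (h' x) x) (hhs : ContDiff ℝ (⊤ : ℕ∞) h) :
    ContDiff ℝ (⊤ : ℕ∞) h' := by
  have : h' = deriv h := funext fun x => (hhd x).deriv.symm
  rw [this]
  exact (contDiff_infty_iff_deriv.1 hhs).2

theorem exists_upperBounds {n : ℕ} {h h' : ℝ → EuclideanSpace ℝ (Fin n)}
    (hhd : ∀ x, HasDerivAt h (h' x) x) (hhs : ContDiff ℝ (⊤ : ℕ∞) h) :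
    ∃ M, 0 < M ∧ ∀ x ∈ Set.Icc (0 : ℝ) 1, ∀ w ∈ Set.Ioo (-(1 : ℝ) / 2) (1 / 2),
      UpperBounds M h h' x w := by
  have hh's := contDiff_of_hasDerivAt hhd hhs
  obtain ⟨hh'd, hh''⟩ := contDiff_infty_iff_deriv.1 hh's
  obtain ⟨A, hA⟩ := (isCompact_Icc (a := (-1 : ℝ)) (b := 2)).exists_bound_of_continuousOn
    hh's.continuous.continuousOn
  obtain ⟨B, hB⟩ := (isCompact_Icc (a := (-1 : ℝ)) (b := 2)).exists_bound_of_continuousOn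
    hh''.continuous.continuousOn
  have hA0 : 0 ≤ A := (norm_nonneg _).trans (hA 0 (by norm_num))
  have hB0 : 0 ≤ B := (norm_nonneg _).trans (hB 0 (by norm_num))
  refine ⟨A + B + 1, by positivity, fun x hx w hw => ?_⟩
  obtain ⟨hx0, hx1⟩ := hx
  obtain ⟨hw0, hw1⟩ := hw
  have hxI : x ∈ Set.Icc (-1 : ℝ) 2 := ⟨by linarith, by linarith⟩
  have hxwI : x + w ∈ Set.Icc (-1 : ℝ) 2 := ⟨by linarith, by linarith⟩
  have hsub : Set.uIcc 0 w ⊆ Set.Icc (-1 - x) (2 - x) :=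
    Set.uIcc_subset_Icc ⟨by linarith, by linarith⟩ ⟨by linarith, by linarith⟩
  refine ⟨(hA x hxI).trans (by linarith), (hA _ hxwI).trans (by linarith), ?_, ?_⟩
  · have := (convex_Icc (-1 : ℝ) 2).norm_image_sub_le_of_norm_hasDerivWithin_le
      (fun y _ => (hhd y).hasDerivWithinAt) hA hxI hxwI
    rw [add_sub_cancel_left, Real.norm_eq_abs] at this
    exact this.trans (mul_le_mul_of_nonneg_right (by linarith) (abs_nonneg w))
  · have hderiv (τ : ℝ) : HasDerivAt (fun τ => h (x + τ) - τ • h' x) (h' (x + τ) - h' x) τ := by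
      have h1 := ((hhd (x + τ)).comp_const_add x τ).sub ((hasDerivAt_id τ).smul_const (h' x))
      rwa [one_smul] at h1
    have hbound (τ : ℝ) (hτ : τ ∈ Set.uIcc 0 w) : ‖h' (x + τ) - h' x‖ ≤ B * |w| := by
      have hτI := hsub hτ
      have := (convex_Icc (-1 : ℝ) 2).norm_image_sub_le_of_norm_deriv_le
        (fun y _ => hh'd y) hB hxI (y := x + τ) ⟨by linarith [hτI.1], by linarith [hτI.2]⟩
      rw [add_sub_cancel_left, Real.norm_eq_abs] at this
      refine this.trans (mul_le_mul_of_nonneg_left ?_ hB0)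
      simpa using Set.abs_sub_left_of_mem_uIcc hτ
    have := (convex_uIcc 0 w).norm_image_sub_le_of_norm_hasDerivWithin_le
      (fun τ _ => (hderiv τ).hasDerivWithinAt) hbound Set.left_mem_uIcc Set.right_mem_uIcc
    rw [zero_smul, sub_zero, add_zero, sub_zero, Real.norm_eq_abs, mul_assoc, ← sq, sq_abs,
      sub_right_comm] at this
    exact this.trans (mul_le_mul_of_nonneg_right (by linarith) (sq_nonneg w))

theorem chord_ne_zero {n : ℕ} {γ : ℝ → EuclideanSpace ℝ (Fin n)}
    (hγper : ∀ x, γ (x + 1) = γ x) (hinj : Set.InjOn γ (Set.Ico (0 : ℝ) 1)) {x w : ℝ}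
    (hw : w ≠ 0) (hw' : |w| < 1) : γ (x + w) - γ x ≠ 0 := by
  have hfr (y : ℝ) : γ (Int.fract y) = γ y := by
    have := Function.Periodic.sub_int_mul_eq (f := γ) (c := 1) hγper ⌊y⌋ (x := y)
    rwa [mul_one] at this
  intro h0
  have hmem (y : ℝ) : Int.fract y ∈ Set.Ico (0 : ℝ) 1 := ⟨Int.fract_nonneg y, Int.fract_lt_one y⟩
  have := hinj (hmem (x + w)) (hmem x) (by rw [hfr, hfr]; exact sub_eq_zero.1 h0)
  obtain ⟨z, hz⟩ := Int.fract_eq_fract.1 this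
  rw [add_sub_cancel_left] at hz
  rw [hz] at hw hw'
  have hz1 : |z| < 1 := by exact_mod_cast hw'
  exact hw (by rw [Int.abs_lt_one_iff.1 hz1, Int.cast_zero])

theorem exists_lowerBounds {n : ℕ} {γ γ' : ℝ → EuclideanSpace ℝ (Fin n)}
    (hγd : ∀ x, HasDerivAt γ (γ' x) x) (hγs : ContDiff ℝ (⊤ : ℕ∞) γ)
    (hγper : ∀ x, γ (x + 1) = γ x) (hreg : ∀ x, γ' x ≠ 0)
    (hinj : Set.InjOn γ (Set.Ico (0 : ℝ) 1)) :
    ∃ c, 0 < c ∧ ∀ x ∈ Set.Icc (0 : ℝ) 1, ∀ w ∈ Set.Ioo (-(1 : ℝ) / 2) (1 / 2),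
      LowerBounds c γ γ' x w := by
  obtain ⟨M, hM, hγ⟩ := exists_upperBounds hγd hγs
  obtain ⟨a, ha, haγ⟩ := (isCompact_Icc (a := (-1 : ℝ)) (b := 2)).exists_forall_le'
    (contDiff_of_hasDerivAt hγd hγs).continuous.norm.continuousOn
    (fun x _ => norm_pos_iff.2 (hreg x))
  have hK : IsCompact ((Set.Icc (0 : ℝ) 1 ×ˢ Set.Icc (-(1 : ℝ) / 2) (1 / 2)) ∩
      {p : ℝ × ℝ | a / (2 * M) ≤ |p.2|}) :=
    (isCompact_Icc.prod isCompact_Icc).inter_right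
      (isClosed_le continuous_const continuous_snd.abs)
  have hγc : Continuous γ := hγs.continuous
  obtain ⟨b, hb, hbγ⟩ := hK.exists_forall_le' (a := 0)
    (f := fun p : ℝ × ℝ => ‖γ (p.1 + p.2) - γ p.1‖) (by fun_prop) (by
      rintro ⟨x, w⟩ ⟨⟨-, hw⟩, hw'⟩
      have hw0 : 0 < |w| := lt_of_lt_of_le (by positivity) hw'
      refine norm_pos_iff.2 (chord_ne_zero hγper hinj (abs_pos.1 hw0) ?_)
      exact abs_lt.2 ⟨by linarith [hw.1], by linarith [hw.2]⟩)
  refine ⟨min (a / 2) b, by positivity, fun x hx w hw => ?_⟩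
  have hw2 : |w| ≤ 1 := abs_le.2 ⟨by linarith [hw.1], by linarith [hw.2]⟩
  have hmin : min (a / 2) b ≤ a := (min_le_left _ _).trans (by linarith)
  refine ⟨hmin.trans (haγ x ⟨by linarith [hx.1], by linarith [hx.2]⟩),
    hmin.trans (haγ _ ⟨by linarith [hx.1, hw.1], by linarith [hx.2, hw.2]⟩), ?_⟩
  rcases le_total |w| (a / (2 * M)) with hwa | hwa
  · have h1 := (hγ x hx w hw).remainder
    have h2 : ‖w • γ' x‖ ≤ ‖γ (x + w) - γ x‖ + ‖γ (x + w) - γ x - w • γ' x‖ :=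
      norm_le_norm_add_norm_sub _ _
    rw [norm_smul, Real.norm_eq_abs] at h2
    have h3 := mul_le_mul_of_nonneg_left
      (haγ x ⟨by linarith [hx.1], by linarith [hx.2]⟩) (abs_nonneg w)
    rw [le_div_iff₀ (by positivity)] at hwa
    rw [← sq_abs] at h1
    nlinarith [mul_le_mul_of_nonneg_left hwa (abs_nonneg w),
      mul_le_mul_of_nonneg_right (min_le_left (a / 2) b) (abs_nonneg w)]
  · have := hbγ (x, w) ⟨⟨hx, Set.Ioo_subset_Icc_self hw⟩, hwa⟩
    calc min (a / 2) b * |w| ≤ b * 1 :=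
          mul_le_mul (min_le_right _ _) hw2 (abs_nonneg w) hb.le
      _ ≤ _ := by simpa using this

section Measurability

variable {n : ℕ} {γ γ' h h' : ℝ → EuclideanSpace ℝ (Fin n)}

theorem measurable_Om (s : ℝ) (hγ : Measurable γ) (hγ' : Measurable γ') (hh : Measurable h)
    (hh' : Measurable h') : Measurable fun p : ℝ × ℝ => Om s γ γ' h h' p.1 p.2 := by
  unfold Om Lg Dg
  fun_prop

theorem measurable_dens (hγ : Measurable γ) (hγ' : Measurable γ') :
    Measurable fun p : ℝ × ℝ => dens γ γ' p.1 p.2 := by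
  unfold dens
  fun_prop

theorem measurable_polarDensity (s : ℝ) (hγ : Measurable γ) (hγ' : Measurable γ')
    (hh : Measurable h) (hh' : Measurable h') :
    Measurable fun p : ℝ × ℝ => polarDensity s γ γ' h h' p.1 p.2 :=
  ((measurable_Om s hγ hγ' hγ hγ').inner (measurable_Om s hγ hγ' hh hh')).mul
    (measurable_dens hγ hγ')

theorem measurable_chordDensity (s : ℝ) (hγ : Measurable γ) (hγ' : Measurable γ')
    (hh : Measurable h) : Measurable fun p : ℝ × ℝ => chordDensity s γ γ' h p.1 p.2 := by
  have h1 := measurable_Om s hγ hγ' hγ hγ'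
  have h2 := measurable_dens hγ hγ'
  unfold chordDensity
  fun_prop

theorem measurable_speedDensity (s : ℝ) (hγ : Measurable γ) (hγ' : Measurable γ')
    (hh' : Measurable h') : Measurable fun p : ℝ × ℝ => speedDensity s γ γ' h' p.1 p.2 := by
  have h1 := measurable_Om s hγ hγ' hγ hγ'
  have h2 := measurable_dens hγ hγ'
  unfold speedDensity Dg
  fun_prop

end Measurability

/-- Lebesgue measure on the domain of integration `[0, 1] × (-1/2, 1/2)`. -/
noncomputable def domainMeasure : Measure (ℝ × ℝ) :=
  (volume.restrict (Set.Icc (0 : ℝ) 1)).prod (volume.restrict (Set.Ioo (-(1 : ℝ) / 2) (1 / 2)))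

theorem ae_domainMeasure {p : ℝ × ℝ → Prop}
    (hp : ∀ x ∈ Set.Icc (0 : ℝ) 1, ∀ w ∈ Set.Ioo (-(1 : ℝ) / 2) (1 / 2), w ≠ 0 → p (x, w)) :
    ∀ᵐ z ∂domainMeasure, p z := by
  rw [domainMeasure, Measure.prod_restrict]
  have h0 : ∀ᵐ z : ℝ × ℝ ∂(volume.prod volume), z.2 ≠ 0 :=
    Measure.quasiMeasurePreserving_snd.ae (Measure.ae_ne volume (0 : ℝ))
  filter_upwards [ae_restrict_mem (measurableSet_Icc.prod measurableSet_Ioo),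
    ae_restrict_of_ae h0] with z hz hz0
  exact hp z.1 hz.1 z.2 hz.2 hz0

theorem integrable_majorant_snd {s c : ℝ} (hs : s ∈ Set.Ioo (3 / 2 : ℝ) 2) (hc : 0 < c) (M : ℝ) :
    Integrable (fun z : ℝ × ℝ => majorant s c M z.2) domainMeasure :=
  Integrable.comp_snd (integrableOn_majorant hs hc M) _

theorem integrable_of_abs_le_majorant {s c M K : ℝ} {f : ℝ → ℝ → ℝ}
    (hs : s ∈ Set.Ioo (3 / 2 : ℝ) 2) (hc : 0 < c) (hf : Measurable fun z : ℝ × ℝ => f z.1 z.2)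
    (hle : ∀ x ∈ Set.Icc (0 : ℝ) 1, ∀ w ∈ Set.Ioo (-(1 : ℝ) / 2) (1 / 2), w ≠ 0 →
      |f x w| ≤ K * majorant s c M w) :
    Integrable (fun z : ℝ × ℝ => f z.1 z.2) domainMeasure :=
  ((integrable_majorant_snd hs hc M).const_mul K).mono' hf.aestronglyMeasurable
    (ae_domainMeasure hle)

theorem integral_domainMeasure {f : ℝ → ℝ → ℝ}
    (hf : Integrable (fun z : ℝ × ℝ => f z.1 z.2) domainMeasure) :
    ∫ z, f z.1 z.2 ∂domainMeasure =
      ∫ x in Set.Icc (0 : ℝ) 1, ∫ w in Set.Ioo (-(1 : ℝ) / 2) (1 / 2), f x w :=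
  integral_prod _ hf

/-- First variation of the tangent-point energy:
`d/dε|₀ TP(γ+εh) = 2B¹_γ(γ,h) − (2s+1)B²_γ(γ,h) + B³_γ(γ,h)`. -/
theorem stmt7 {n : ℕ} (hn : 2 ≤ n) (s : ℝ) (hs : s ∈ Set.Ioo (3/2 : ℝ) 2)
    (γ γ' h h' : ℝ → EuclideanSpace ℝ (Fin n))
    (hγd : ∀ x, HasDerivAt γ (γ' x) x) (hγs : ContDiff ℝ (⊤ : ℕ∞) γ)
    (hγper : ∀ x, γ (x + 1) = γ x)
    (hreg : ∀ x, γ' x ≠ 0)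
    (hinj : Set.InjOn γ (Set.Ico (0:ℝ) 1))
    (hhd : ∀ x, HasDerivAt h (h' x) x) (hhs : ContDiff ℝ (⊤ : ℕ∞) h)
    (hhper : ∀ x, h (x + 1) = h x) :
    HasDerivAt
      (fun ε : ℝ =>
        TPr s (fun x => γ x + ε • h x) (fun x => γ' x + ε • h' x))
      (2 * (∫ x in Set.Icc (0:ℝ) 1, ∫ w in Set.Ioo (-(1:ℝ)/2) (1/2),
          ⟪Om s γ γ' γ γ' x w, Om s γ γ' h h' x w⟫ * dens γ γ' x w)
        - (2 * s + 1) * (∫ x in Set.Icc (0:ℝ) 1, ∫ w in Set.Ioo (-(1:ℝ)/2) (1/2),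
            ‖Om s γ γ' γ γ' x w‖ ^ 2 *
              (⟪γ (x + w) - γ x, h (x + w) - h x⟫ / ‖γ (x + w) - γ x‖ ^ 2) *
              dens γ γ' x w)
        + ∫ x in Set.Icc (0:ℝ) 1, ∫ w in Set.Ioo (-(1:ℝ)/2) (1/2),
            ‖Om s γ γ' γ γ' x w‖ ^ 2 *
              (⟪Dg γ' γ' x, Dg γ' h' x⟫ + ⟪Dg γ' γ' (x + w), Dg γ' h' (x + w)⟫) *
              dens γ γ' x w)
      0 := by
  obtain ⟨hs1, hs2⟩ := hs
  have hs0 : 0 < s := by linarith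
  have hγ's := contDiff_of_hasDerivAt hγd hγs
  have hh's := contDiff_of_hasDerivAt hhd hhs
  obtain ⟨M₁, hM₁, hγb⟩ := exists_upperBounds hγd hγs
  obtain ⟨M₂, hM₂, hhb⟩ := exists_upperBounds hhd hhs
  obtain ⟨c, hc, hl⟩ := exists_lowerBounds hγd hγs hγper hreg hinj
  obtain ⟨M, hM, hMγ, hMh⟩ : ∃ M, 0 < M ∧ M₁ ≤ M ∧ M₂ ≤ M :=
    ⟨max M₁ M₂, by positivity, le_max_left _ _, le_max_right _ _⟩
  let r := min 1 (c / (2 * M))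
  have hr : 0 < r := by positivity
  let Γ : ℝ → ℝ → EuclideanSpace ℝ (Fin n) := fun ε x => γ x + ε • h x
  let Γ' : ℝ → ℝ → EuclideanSpace ℝ (Fin n) := fun ε x => γ' x + ε • h' x
  have hbounds (ε : ℝ) (hε : ε ∈ Metric.ball (0 : ℝ) r) (x : ℝ) (hx : x ∈ Set.Icc (0 : ℝ) 1)
      (w : ℝ) (hw : w ∈ Set.Ioo (-(1 : ℝ) / 2) (1 / 2)) :
      LowerBounds (c / 2) (Γ ε) (Γ' ε) x w ∧ UpperBounds (2 * M) (Γ ε) (Γ' ε) x w ∧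
        UpperBounds (2 * M) h h' x w := by
    have hε' : |ε| < r := by simpa using hε
    have h1 : |ε| ≤ 1 := hε'.le.trans (min_le_left _ _)
    have h2 : |ε| * M ≤ c / 2 := by
      have := hε'.le.trans (min_le_right _ _)
      rw [le_div_iff₀ (by positivity)] at this
      linarith
    have hhM := (hhb x hx w hw).mono hMh
    exact ⟨(hl x hx w hw).add_smul hhM h2, ((hγb x hx w hw).mono hMγ).add_smul hhM h1,
      hhM.mono (by linarith)⟩
  have hc2 : 0 < c / 2 := by positivity
  have hmh : Measurable h := hhs.continuous.measurable
  have hmh' : Measurable h' := hh's.continuous.measurable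
  have hmΓ (ε : ℝ) : Measurable (Γ ε) := hγs.continuous.measurable.add (hmh.const_smul ε)
  have hmΓ' (ε : ℝ) : Measurable (Γ' ε) := hγ's.continuous.measurable.add (hmh'.const_smul ε)
  have hFint (ε : ℝ) (hε : ε ∈ Metric.ball (0 : ℝ) r) : Integrable
      (fun z : ℝ × ℝ => polarDensity s (Γ ε) (Γ' ε) (Γ ε) (Γ' ε) z.1 z.2) domainMeasure :=
    integrable_of_abs_le_majorant (M := 2 * M) (K := 1) ⟨hs1, hs2⟩ hc2
      (measurable_polarDensity s (hmΓ ε) (hmΓ' ε) (hmΓ ε) (hmΓ' ε)) fun x hx w hw hw0 => by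
        obtain ⟨hb1, hb2, hb3⟩ := hbounds ε hε x hx w hw
        rw [one_mul]
        exact abs_polarDensity_le hs0 hc2 hw0 hb1 hb2 hb2
  have h0 : (0 : ℝ) ∈ Metric.ball (0 : ℝ) r := Metric.mem_ball_self hr
  have hΓ0 : Γ 0 = γ := funext fun x => by simp [Γ]
  have hΓ'0 : Γ' 0 = γ' := funext fun x => by simp [Γ']
  have hpolar := integrable_of_abs_le_majorant (M := 2 * M) (K := 1) ⟨hs1, hs2⟩ hc2
    (measurable_polarDensity s (hmΓ 0) (hmΓ' 0) hmh hmh') fun x hx w hw hw0 => by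
      obtain ⟨hb1, hb2, hb3⟩ := hbounds 0 h0 x hx w hw
      rw [one_mul]
      exact abs_polarDensity_le hs0 hc2 hw0 hb1 hb2 hb3
  have hchord := integrable_of_abs_le_majorant ⟨hs1, hs2⟩ hc2
    (measurable_chordDensity s (hmΓ 0) (hmΓ' 0) hmh) fun x hx w hw hw0 => by
      obtain ⟨hb1, hb2, hb3⟩ := hbounds 0 h0 x hx w hw
      exact abs_chordDensity_le hs0 hc2 hw0 hb1 hb2 hb3
  have hspeed := integrable_of_abs_le_majorant ⟨hs1, hs2⟩ hc2
    (measurable_speedDensity s (hmΓ 0) (hmΓ' 0) hmh') fun x hx w hw hw0 => by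
      obtain ⟨hb1, hb2, hb3⟩ := hbounds 0 h0 x hx w hw
      exact abs_speedDensity_le hs0 hc2 hw0 hb1 hb2 hb3
  have key := (hasDerivAt_integral_of_dominated_loc_of_deriv_le (μ := domainMeasure)
    (F := fun ε z => polarDensity s (Γ ε) (Γ' ε) (Γ ε) (Γ' ε) z.1 z.2)
    (F' := fun ε z => variationDensity s (Γ ε) (Γ' ε) h h' z.1 z.2)
    (Metric.ball_mem_nhds (0 : ℝ) hr)
    (Filter.Eventually.of_forall fun ε => (measurable_polarDensity s (hmΓ ε) (hmΓ' ε) (hmΓ ε)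
      (hmΓ' ε)).aestronglyMeasurable)
    (hFint 0 h0)
    (((hpolar.const_mul 2).sub (hchord.const_mul (2 * s + 1))).add hspeed).aestronglyMeasurable
    (ae_domainMeasure fun x hx w hw hw0 ε hε => by
      obtain ⟨hb1, hb2, hb3⟩ := hbounds ε hε x hx w hw
      exact abs_variationDensity_le hs0 hc2 hw0 hb1 hb2 hb3)
    ((integrable_majorant_snd ⟨hs1, hs2⟩ hc2 (2 * M)).const_mul _)
    (ae_domainMeasure fun x hx w hw hw0 ε hε => by
      obtain ⟨hb1, -, -⟩ := hbounds ε hε x hx w hw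
      simp only [polarDensity_self]
      exact hasDerivAt_energyDensity_add_smul hs0 γ γ' h h'
        (norm_pos_iff.1 (hc2.trans_le hb1.left)) (norm_pos_iff.1 (hc2.trans_le hb1.right))
        (norm_pos_iff.1 ((mul_pos hc2 (abs_pos.2 hw0)).trans_le hb1.chord)))).2
  have hsum : ∫ z, variationDensity s (Γ 0) (Γ' 0) h h' z.1 z.2 ∂domainMeasure =
      2 * (∫ z, polarDensity s (Γ 0) (Γ' 0) h h' z.1 z.2 ∂domainMeasure)
        - (2 * s + 1) * (∫ z, chordDensity s (Γ 0) (Γ' 0) h z.1 z.2 ∂domainMeasure)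
        + ∫ z, speedDensity s (Γ 0) (Γ' 0) h' z.1 z.2 ∂domainMeasure := by
    rw [← integral_const_mul, ← integral_const_mul,
      ← integral_sub (hpolar.const_mul 2) (hchord.const_mul (2 * s + 1))]
    exact integral_add ((hpolar.const_mul 2).sub (hchord.const_mul (2 * s + 1))) hspeed
  rw [hsum, integral_domainMeasure hpolar, integral_domainMeasure hchord,
    integral_domainMeasure hspeed, hΓ0, hΓ'0] at key
  refine HasDerivAt.congr_of_eventuallyEq key ?_
  filter_upwards [Metric.ball_mem_nhds (0 : ℝ) hr] with ε hε
  rw [integral_domainMeasure (hFint ε hε)]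
  simp only [polarDensity_self]
  rfl
end

section
/- Let s ∈ (3/2,2), and let γ, k, ψ₁, ψ₂ : ℝ → ℝⁿ be smooth 1-periodic maps with γ'(x) ≠ 0 for all x and γ injective on [0,1). Define for a regular injective curve η the quantity B²_η(ψ₁,ψ₂) = ∫₀¹∫_{−1/2}^{1/2} |P⊥_{η'(x)}(Δ_w η(x))|² / |Δ_w η(x)|^{2s+3} · ⟨Δ_w ψ₁(x), Δ_w ψ₂(x)⟩ · |η'(x)||η'(x+w)| dw dx. Then ε ↦ B²_{γ+εk}(ψ₁,ψ₂) is differentiable at ε = 0 and its derivative equals −(2s+3) ∬ |Ω^s_γ γ|² (⟨Δ_w ψ₁, Δ_w ψ₂⟩/|Δ_w γ|²)(⟨Δ_w γ, Δ_w k⟩/|Δ_w γ|²) dμ_γ + 2 ∬ ⟨Ω^s_γ γ, Ω^s_γ k⟩ (⟨Δ_w ψ₁, Δ_w ψ₂⟩/|Δ_w γ|²) dμ_γ + ∬ |Ω^s_γ γ|² (⟨Δ_w ψ₁, Δ_w ψ₂⟩/|Δ_w γ|²) ( ⟨D_γ γ(x), D_γ k(x)⟩ + ⟨D_γ γ(x+w),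 D_γ k(x+w)⟩ ) dμ_γ. -/
open MeasureTheory
open scoped RealInnerProductSpace ENNReal

/-- Orthogonal projection onto the orthogonal complement of `ℝu`. -/
noncomputable def Pperp {n : ℕ} (u v : EuclideanSpace ℝ (Fin n)) :
    EuclideanSpace ℝ (Fin n) :=
  v - (⟪u, v⟫ / ‖u‖ ^ 2) • u

/-- The bilinear form `B²_η(ψ₁,ψ₂)`. -/
noncomputable def B2 {n : ℕ} (s : ℝ)
    (η η' ψ₁ ψ₂ : ℝ → EuclideanSpace ℝ (Fin n)) : ℝ :=
  ∫ x in Set.Icc (0:ℝ) 1, ∫ w in Set.Ioo (-(1:ℝ)/2) (1/2),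
    ‖Pperp (η' x) (η (x + w) - η x)‖ ^ 2 / ‖η (x + w) - η x‖ ^ (2*s+3) *
      ⟪ψ₁ (x + w) - ψ₁ x, ψ₂ (x + w) - ψ₂ x⟫ * (‖η' x‖ * ‖η' (x + w)‖)

section VectorEstimates

variable {n : ℕ}

lemma norm_Pperp_sq (u v : EuclideanSpace ℝ (Fin n)) :
    ‖Pperp u v‖ ^ 2 = ‖v‖ ^ 2 - ⟪u, v⟫ ^ 2 / ‖u‖ ^ 2 := by
  by_cases hu : ‖u‖ = 0
  · have : u = 0 := norm_eq_zero.mp hu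
    simp [Pperp, this]
  · rw [Pperp, norm_sub_sq_real, inner_smul_right, norm_smul, real_inner_comm v u, mul_pow,
      Real.norm_eq_abs, sq_abs]
    field_simp
    ring

lemma norm_Pperp_le (u v : EuclideanSpace ℝ (Fin n)) : ‖Pperp u v‖ ≤ ‖v‖ := by
  have h := norm_Pperp_sq u v
  have : 0 ≤ ⟪u, v⟫ ^ 2 / ‖u‖ ^ 2 := by positivity
  exact le_of_sq_le_sq (by linarith) (norm_nonneg v)

lemma Pperp_sub_smul {u : EuclideanSpace ℝ (Fin n)} (hu : u ≠ 0)
    (v : EuclideanSpace ℝ (Fin n)) (w : ℝ) : Pperp u (v - w • u) = Pperp u v := by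
  have hu' : ‖u‖ ^ 2 ≠ 0 := pow_ne_zero 2 (norm_ne_zero_iff.mpr hu)
  rw [Pperp, Pperp, inner_sub_right, inner_smul_right, real_inner_self_eq_norm_sq, sub_div,
    mul_div_cancel_right₀ _ hu']
  module

lemma inner_Pperp_self {u : EuclideanSpace ℝ (Fin n)} (hu : u ≠ 0)
    (v : EuclideanSpace ℝ (Fin n)) : ⟪Pperp u v, u⟫ = 0 := by
  have hu' : ‖u‖ ^ 2 ≠ 0 := pow_ne_zero 2 (norm_ne_zero_iff.mpr hu)
  rw [Pperp, inner_sub_left, inner_smul_left, real_inner_self_eq_norm_sq, real_inner_comm]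
  simp [div_mul_cancel₀ _ hu']

lemma HasDerivAt.norm_of_ne_zero {f : ℝ → EuclideanSpace ℝ (Fin n)}
    {f' : EuclideanSpace ℝ (Fin n)} {t : ℝ} (hf : HasDerivAt f f' t) (h0 : f t ≠ 0) :
    HasDerivAt (fun t => ‖f t‖) (⟪f t, f'⟫ / ‖f t‖) t := by
  have h := hf.norm_sq.sqrt (pow_ne_zero 2 (norm_ne_zero_iff.mpr h0))
  simp only [Real.sqrt_sq (norm_nonneg _)] at h
  convert h using 1
  rw [mul_div_mul_left _ _ two_ne_zero]

/-- The derivative of the squared projection, in terms of the derivatives `u'`, `v'`. -/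
lemma HasDerivAt.norm_Pperp_sq {u v : ℝ → EuclideanSpace ℝ (Fin n)}
    {u' v' : EuclideanSpace ℝ (Fin n)} {t : ℝ} (hu : HasDerivAt u u' t) (hv : HasDerivAt v v' t)
    (hu0 : u t ≠ 0) :
    HasDerivAt (fun t => ‖Pperp (u t) (v t)‖ ^ 2)
      (2 * ⟪Pperp (u t) (v t), v' - (⟪u t, v t⟫ / ‖u t‖ ^ 2) • u'⟫) t := by
  have hne : ‖u t‖ ≠ 0 := norm_ne_zero_iff.mpr hu0
  simp only [_root_.norm_Pperp_sq]
  refine (hv.norm_sq.sub (((hu.inner ℝ hv).pow 2).div hu.norm_sq (pow_ne_zero 2 hne))).congr_deriv ?_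
  rw [Pperp, inner_sub_left, inner_sub_right, inner_sub_right, inner_smul_left, inner_smul_left,
    inner_smul_right, inner_smul_right, real_inner_comm u' (v t)]
  simp only [conj_trivial, Pi.pow_apply]
  field_simp
  ring

/-- The integrand of `B²`, as a function of `u = η'(x)`, `v = Δη`, `u₂ = η'(x+w)` and
`b = ⟨Δψ₁, Δψ₂⟩`, with exponent `p = 2s+3`, has the expected derivative. -/
lemma hasDerivAt_B2_integrand (p b : ℝ) {u v u₂ : ℝ → EuclideanSpace ℝ (Fin n)}
    {u' v' u₂' : EuclideanSpace ℝ (Fin n)} {t : ℝ} (hu : HasDerivAt u u' t)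
    (hv : HasDerivAt v v' t) (hu₂ : HasDerivAt u₂ u₂' t)
    (hu0 : u t ≠ 0) (hv0 : v t ≠ 0) (hu₂0 : u₂ t ≠ 0) :
    HasDerivAt (fun t => ‖Pperp (u t) (v t)‖ ^ 2 / ‖v t‖ ^ p * b * (‖u t‖ * ‖u₂ t‖))
      (-p * (‖Pperp (u t) (v t)‖ ^ 2 / ‖v t‖ ^ p * b *
          (⟪v t, v'⟫ / ‖v t‖ ^ 2 * (‖u t‖ * ‖u₂ t‖)))
        + 2 * (⟪Pperp (u t) (v t), v' - (⟪u t, v t⟫ / ‖u t‖ ^ 2) • u'⟫ / ‖v t‖ ^ p * b *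
          (‖u t‖ * ‖u₂ t‖))
        + ‖Pperp (u t) (v t)‖ ^ 2 / ‖v t‖ ^ p * b *
          ((⟪u t, u'⟫ / ‖u t‖ ^ 2 + ⟪u₂ t, u₂'⟫ / ‖u₂ t‖ ^ 2) * (‖u t‖ * ‖u₂ t‖))) t := by
  have hne : ‖u t‖ ≠ 0 := norm_ne_zero_iff.mpr hu0
  have hne₂ : ‖u₂ t‖ ≠ 0 := norm_ne_zero_iff.mpr hu₂0
  have hvne : ‖v t‖ ≠ 0 := norm_ne_zero_iff.mpr hv0
  have hvp : 0 < ‖v t‖ := norm_pos_iff.mpr hv0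
  have hp : ‖v t‖ ^ p ≠ 0 := (Real.rpow_pos_of_pos hvp p).ne'
  have h := (((hu.norm_Pperp_sq hv hu0).div
    ((hv.norm_of_ne_zero hv0).rpow_const (p := p) (Or.inl hvne)) hp).mul_const b).mul
      ((hu.norm_of_ne_zero hu0).mul (hu₂.norm_of_ne_zero hu₂0))
  refine h.congr_deriv ?_
  rw [Real.rpow_sub_one hvne]
  simp only [Pi.mul_apply, Pi.div_apply]
  field_simp
  ring

lemma abs_div_rpow_mul_mul_le {p c A B G W V q b g : ℝ} (hc : 0 < c) (hA : 0 ≤ A) (hB : 0 ≤ B)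
    (hp : 0 ≤ p) (hW : 0 < W) (hV : c * W ≤ V) (hq : |q| ≤ A * W ^ 4) (hb : |b| ≤ B * W ^ 2)
    (hg : |g| ≤ G) :
    |q / V ^ p * b * g| ≤ A * B * G / c ^ p * W ^ (6 - p) := by
  have hcW : 0 < c * W := mul_pos hc hW
  have hV0 : 0 < V := hcW.trans_le hV
  have hVp : (c * W) ^ p ≤ V ^ p := Real.rpow_le_rpow hcW.le hV hp
  have hcWp : 0 < (c * W) ^ p := Real.rpow_pos_of_pos hcW p
  have hG : 0 ≤ G := (abs_nonneg g).trans hg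
  rw [abs_mul, abs_mul, abs_div, abs_of_pos (hcWp.trans_le hVp)]
  calc |q| / V ^ p * |b| * |g| ≤ (A * W ^ 4) / (c * W) ^ p * (B * W ^ 2) * G := by gcongr
    _ = A * B * G / c ^ p * W ^ (6 - p) := by
      rw [Real.mul_rpow hc.le hW.le, Real.rpow_sub hW,
        show (6 : ℝ) = ((6 : ℕ) : ℝ) by norm_num, Real.rpow_natCast]
      have := (Real.rpow_pos_of_pos hc p).ne'
      have := (Real.rpow_pos_of_pos hW p).ne'
      field_simp

lemma abs_inner_div_le {c K : ℝ} (hc : 0 < c) (x y : EuclideanSpace ℝ (Fin n)) {W : ℝ}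
    (hW : 0 < W) (hx : c * W ≤ ‖x‖) (hy : ‖y‖ ≤ K * W) : |⟪x, y⟫ / ‖x‖ ^ 2| ≤ K / c := by
  have hx0 : 0 < ‖x‖ := (mul_pos hc hW).trans_le hx
  have hKW : 0 ≤ K * W := (norm_nonneg y).trans hy
  have hK : 0 ≤ K := nonneg_of_mul_nonneg_left hKW hW
  rw [abs_div, abs_of_pos (pow_pos hx0 2), div_le_div_iff₀ (pow_pos hx0 2) hc]
  calc |⟪x, y⟫| * c ≤ (‖x‖ * (K * W)) * c := by
        gcongr; exact (abs_real_inner_le_norm x y).trans (by gcongr)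
    _ = K * ‖x‖ * (c * W) := by ring
    _ ≤ K * ‖x‖ * ‖x‖ := by gcongr
    _ = K * ‖x‖ ^ 2 := by ring

/-- Quantitative control of first-order Taylor data: `u`, `u₂` play the role of the derivatives at
`x` and `x+w`, `v` that of the increment `Δ_w`, and primes denote the variation. -/
structure IncrementBounds (c K w : ℝ) (u v u₂ u' v' u₂' : EuclideanSpace ℝ (Fin n)) : Prop where
  le_norm_u : c ≤ ‖u‖
  le_norm_u₂ : c ≤ ‖u₂‖
  le_norm_v : c * |w| ≤ ‖v‖
  norm_u_le : ‖u‖ ≤ K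
  norm_u₂_le : ‖u₂‖ ≤ K
  norm_u'_le : ‖u'‖ ≤ K
  norm_u₂'_le : ‖u₂'‖ ≤ K
  norm_v'_le : ‖v'‖ ≤ K * |w|
  norm_v_sub_le : ‖v - w • u‖ ≤ K * |w| ^ 2
  norm_v'_sub_le : ‖v' - w • u'‖ ≤ K * |w| ^ 2

variable {c K w : ℝ} {u v u₂ u' v' u₂' : EuclideanSpace ℝ (Fin n)}

lemma IncrementBounds.mono (h : IncrementBounds c K w u v u₂ u' v' u₂') {K' : ℝ} (hK : K ≤ K') :
    IncrementBounds c K' w u v u₂ u' v' u₂' :=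
  ⟨h.1, h.2, h.3, h.4.trans hK, h.5.trans hK, h.6.trans hK, h.7.trans hK,
    h.8.trans (by gcongr), h.9.trans (by gcongr), h.10.trans (by gcongr)⟩

lemma IncrementBounds.norm_Pperp_le (h : IncrementBounds c K w u v u₂ u' v' u₂') (hc : 0 < c) :
    ‖Pperp u v‖ ≤ K * |w| ^ 2 := by
  have hu : u ≠ 0 := norm_pos_iff.mp (hc.trans_le h.le_norm_u)
  rw [← Pperp_sub_smul hu v w]
  exact (_root_.norm_Pperp_le _ _).trans h.norm_v_sub_le

lemma IncrementBounds.norm_variation_le (h : IncrementBounds c K w u v u₂ u' v' u₂')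
    (hc : 0 < c) : ‖v' - (⟪u, v⟫ / ‖u‖ ^ 2) • u'‖ ≤ (K + K / c * K) * |w| ^ 2 := by
  have hu0 : 0 < ‖u‖ := hc.trans_le h.le_norm_u
  have hu' : ‖u‖ ^ 2 ≠ 0 := (pow_pos hu0 2).ne'
  have key : v' - (⟪u, v⟫ / ‖u‖ ^ 2) • u'
      = (v' - w • u') - (⟪u, v - w • u⟫ / ‖u‖ ^ 2) • u' := by
    rw [inner_sub_right, inner_smul_right, real_inner_self_eq_norm_sq, sub_div,
      mul_div_cancel_right₀ _ hu']
    module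
  have hb : |⟪u, v - w • u⟫ / ‖u‖ ^ 2| ≤ K * |w| ^ 2 / c :=
    abs_inner_div_le (W := 1) hc u _ one_pos (by simpa using h.le_norm_u)
      (by simpa using h.norm_v_sub_le)
  rw [key]
  calc _ ≤ ‖v' - w • u'‖ + ‖(⟪u, v - w • u⟫ / ‖u‖ ^ 2) • u'‖ := norm_sub_le _ _
    _ ≤ K * |w| ^ 2 + K * |w| ^ 2 / c * K := by
      rw [norm_smul, Real.norm_eq_abs]
      have h0 := (abs_nonneg _).trans hb
      gcongr
      · exact h.norm_v'_sub_le
      · exact h.norm_u'_le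
    _ = _ := by ring

/-- All terms in the derivative of the integrand of `B²`, as well as the integrand itself, are
dominated by a multiple of `|w|^(6-p)`. -/
lemma exists_forall_B2_terms_le {p : ℝ} (hp : 0 ≤ p) (hc : 0 < c) (hK : 0 ≤ K) :
    ∃ C : ℝ, ∀ (w b : ℝ) (u v u₂ u' v' u₂' : EuclideanSpace ℝ (Fin n)), w ≠ 0 →
      IncrementBounds c K w u v u₂ u' v' u₂' → |b| ≤ K * |w| ^ 2 →
      |‖Pperp u v‖ ^ 2 / ‖v‖ ^ p * b * (‖u‖ * ‖u₂‖)| ≤ C * |w| ^ (6 - p) ∧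
      |‖Pperp u v‖ ^ 2 / ‖v‖ ^ p * b * (⟪v, v'⟫ / ‖v‖ ^ 2 * (‖u‖ * ‖u₂‖))|
        ≤ C * |w| ^ (6 - p) ∧
      |⟪Pperp u v, v' - (⟪u, v⟫ / ‖u‖ ^ 2) • u'⟫ / ‖v‖ ^ p * b * (‖u‖ * ‖u₂‖)|
        ≤ C * |w| ^ (6 - p) ∧
      |‖Pperp u v‖ ^ 2 / ‖v‖ ^ p * b *
        ((⟪u, u'⟫ / ‖u‖ ^ 2 + ⟪u₂, u₂'⟫ / ‖u₂‖ ^ 2) * (‖u‖ * ‖u₂‖))| ≤ C * |w| ^ (6 - p) := by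
  set A := (K + K / c * K) ^ 2
  set G := max (K * K) (max (K / c * (K * K)) ((K / c + K / c) * (K * K)))
  refine ⟨A * K * G / c ^ p, fun w b u v u₂ u' v' u₂' hw h hb => ?_⟩
  have hW : 0 < |w| := abs_pos.mpr hw
  have hKc : 0 ≤ K / c * K := by positivity
  have hP : ‖Pperp u v‖ ≤ (K + K / c * K) * |w| ^ 2 :=
    (h.norm_Pperp_le hc).trans (by gcongr; linarith)
  have hq : |‖Pperp u v‖ ^ 2| ≤ A * |w| ^ 4 := by
    rw [abs_of_nonneg (by positivity)]
    calc _ ≤ ((K + K / c * K) * |w| ^ 2) ^ 2 := by gcongr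
      _ = _ := by ring
  have hq' : |⟪Pperp u v, v' - (⟪u, v⟫ / ‖u‖ ^ 2) • u'⟫| ≤ A * |w| ^ 4 := by
    calc _ ≤ ‖Pperp u v‖ * ‖v' - (⟪u, v⟫ / ‖u‖ ^ 2) • u'‖ := abs_real_inner_le_norm _ _
      _ ≤ ((K + K / c * K) * |w| ^ 2) * ((K + K / c * K) * |w| ^ 2) := by
        gcongr
        exact h.norm_variation_le hc
      _ = _ := by ring
  have hU : |‖u‖ * ‖u₂‖| ≤ K * K := by
    rw [abs_of_nonneg (by positivity)]
    have := h.norm_u_le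
    have := h.norm_u₂_le
    gcongr
  have hA : 0 ≤ A := by positivity
  have hg₁ : |⟪v, v'⟫ / ‖v‖ ^ 2 * (‖u‖ * ‖u₂‖)| ≤ K / c * (K * K) := by
    rw [abs_mul]
    gcongr
    exact abs_inner_div_le hc v v' hW h.le_norm_v h.norm_v'_le
  have hg₂ : |(⟪u, u'⟫ / ‖u‖ ^ 2 + ⟪u₂, u₂'⟫ / ‖u₂‖ ^ 2) * (‖u‖ * ‖u₂‖)|
      ≤ (K / c + K / c) * (K * K) := by
    rw [abs_mul]
    gcongr
    refine (abs_add_le _ _).trans (add_le_add ?_ ?_)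
    · exact abs_inner_div_le (W := 1) hc u u' one_pos (by simpa using h.le_norm_u)
        (by simpa using h.norm_u'_le)
    · exact abs_inner_div_le (W := 1) hc u₂ u₂' one_pos (by simpa using h.le_norm_u₂)
        (by simpa using h.norm_u₂'_le)
  have hG₁ : K * K ≤ G := le_max_left _ _
  have hG₂ : K / c * (K * K) ≤ G := (le_max_left _ _).trans (le_max_right _ _)
  have hG₃ : (K / c + K / c) * (K * K) ≤ G := (le_max_right _ _).trans (le_max_right _ _)
  exact ⟨abs_div_rpow_mul_mul_le hc hA hK hp hW h.le_norm_v hq hb (hU.trans hG₁),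
    abs_div_rpow_mul_mul_le hc hA hK hp hW h.le_norm_v hq hb (hg₁.trans hG₂),
    abs_div_rpow_mul_mul_le hc hA hK hp hW h.le_norm_v hq' hb (hU.trans hG₁),
    abs_div_rpow_mul_mul_le hc hA hK hp hW h.le_norm_v hq hb (hg₂.trans hG₃)⟩

end VectorEstimates

section PeriodicCurves

variable {n : ℕ}

/-- A smooth periodic map has bounded derivative and uniformly controlled first-order Taylor
expansion. -/
lemma exists_taylor_bounds {h h' : ℝ → EuclideanSpace ℝ (Fin n)}
    (hd : ∀ x, HasDerivAt h (h' x) x) (hs : ContDiff ℝ (⊤ : ℕ∞) h)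
    (hper : ∀ x, h (x + 1) = h x) :
    Continuous h' ∧ ∃ K : ℝ, 0 ≤ K ∧ (∀ x, ‖h' x‖ ≤ K) ∧
      (∀ x w, ‖h (x + w) - h x‖ ≤ K * |w|) ∧
      (∀ x w, ‖h (x + w) - h x - w • h' x‖ ≤ K * |w| ^ 2) := by
  have hderiv : deriv h = h' := funext fun x => (hd x).deriv
  have hs' : ContDiff ℝ (⊤ : ℕ∞) h' := hderiv ▸ (contDiff_infty_iff_deriv.mp hs).2
  have hc' : Continuous h' := hs'.continuous
  have hc'' : Continuous (deriv h') := (contDiff_infty_iff_deriv.mp hs').2.continuous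
  have hper' : Function.Periodic h' 1 := fun x => by
    have := (hd (x + 1)).comp_add_const x 1
    simp only [hper] at this
    exact this.unique (hd x)
  have hper'' : Function.Periodic (deriv h') 1 := fun x => by
    rw [← deriv_comp_add_const, show (fun y => h' (y + 1)) = h' from funext hper']
  obtain ⟨K₁, hK₁⟩ := (hper'.isBounded_of_continuous one_ne_zero hc').exists_norm_le
  obtain ⟨K₂, hK₂⟩ := (hper''.isBounded_of_continuous one_ne_zero hc'').exists_norm_le
  have hK₁' : ∀ x, ‖h' x‖ ≤ K₁ := fun x => hK₁ _ (Set.mem_range_self x)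
  have hK₂' : ∀ x, ‖deriv h' x‖ ≤ K₂ := fun x => hK₂ _ (Set.mem_range_self x)
  have hlip : ∀ x y, ‖h' y - h' x‖ ≤ K₂ * ‖y - x‖ := fun x y =>
    convex_univ.norm_image_sub_le_of_norm_hasDerivWithin_le
      (fun z _ => (((contDiff_infty_iff_deriv.mp hs').1 z).hasDerivAt).hasDerivWithinAt)
      (fun z _ => hK₂' z) (Set.mem_univ x) (Set.mem_univ y)
  have hK₂0 : 0 ≤ K₂ := (norm_nonneg _).trans (hK₂' 0)
  refine ⟨hc', max K₁ K₂, le_max_of_le_right hK₂0, fun x => (hK₁' x).trans (le_max_left _ _),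
    fun x w => ?_, fun x w => ?_⟩
  · have := convex_univ.norm_image_sub_le_of_norm_hasDerivWithin_le
      (fun z _ => (hd z).hasDerivWithinAt)
      (fun z _ => hK₁' z) (Set.mem_univ x) (Set.mem_univ (x + w))
    rw [add_sub_cancel_left, Real.norm_eq_abs] at this
    exact this.trans (by gcongr; exact le_max_left _ _)
  · have hg : ∀ t, HasDerivAt (fun t => h (x + t) - t • h' x) (h' (x + t) - h' x) t := fun t => by
      simpa using ((hd (x + t)).comp_const_add x t).fun_sub ((hasDerivAt_id t).smul_const (h' x))
    have := (convex_uIcc (0 : ℝ) w).norm_image_sub_le_of_norm_hasDerivWithin_le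
      (C := K₂ * |w|) (fun t _ => (hg t).hasDerivWithinAt) (fun t ht => ?_)
      Set.left_mem_uIcc Set.right_mem_uIcc
    · simp only [add_zero, zero_smul, sub_zero, Real.norm_eq_abs] at this
      calc _ = ‖h (x + w) - w • h' x - h x‖ := by congr 1; abel
        _ ≤ K₂ * |w| * |w| := this
        _ = K₂ * |w| ^ 2 := by ring
        _ ≤ _ := by gcongr; exact le_max_right _ _
    · refine (hlip x (x + t)).trans ?_
      rw [add_sub_cancel_left, Real.norm_eq_abs]
      have := Set.abs_sub_left_of_mem_uIcc ht
      simp only [sub_zero] at this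
      gcongr

/-- A periodic map injective on `[0,1)` separates `x + w` from `x` for `0 < |w| < 1`. -/
lemma increment_ne_zero {γ : ℝ → EuclideanSpace ℝ (Fin n)} (hper : ∀ x, γ (x + 1) = γ x)
    (hinj : Set.InjOn γ (Set.Ico (0 : ℝ) 1)) (x : ℝ) {w : ℝ} (hw : w ≠ 0) (hw1 : |w| < 1) :
    γ (x + w) - γ x ≠ 0 := by
  intro h
  have hfr : ∀ y, γ (Int.fract y) = γ y := fun y => by
    have := Function.Periodic.sub_int_mul_eq (f := γ) (c := 1) hper (x := y) ⌊y⌋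
    rwa [mul_one] at this
  have h1 : Int.fract (x + w) = Int.fract x :=
    hinj ⟨Int.fract_nonneg _, Int.fract_lt_one _⟩ ⟨Int.fract_nonneg _, Int.fract_lt_one _⟩
      (by rw [hfr, hfr]; exact sub_eq_zero.mp h)
  obtain ⟨z, hz⟩ := Int.fract_eq_fract.mp h1
  rw [add_sub_cancel_left] at hz
  subst hz
  have hz1 : |z| < 1 := by exact_mod_cast hw1
  exact hw (by exact_mod_cast Int.abs_lt_one_iff.mp hz1)

/-- A regular periodic simple curve is uniformly bi-Lipschitz in the increment. -/
lemma exists_le_norm_increment {γ γ' : ℝ → EuclideanSpace ℝ (Fin n)}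
    (hγ : Continuous γ) (hγ' : Continuous γ') (hreg : ∀ x, γ' x ≠ 0)
    (hper : ∀ x, γ (x + 1) = γ x) (hinj : Set.InjOn γ (Set.Ico (0 : ℝ) 1))
    {K : ℝ} (hK : 0 ≤ K)
    (htaylor : ∀ x w, ‖γ (x + w) - γ x - w • γ' x‖ ≤ K * |w| ^ 2) :
    ∃ c : ℝ, 0 < c ∧ (∀ x ∈ Set.Icc (-1 : ℝ) 2, c ≤ ‖γ' x‖) ∧
      ∀ x ∈ Set.Icc (0 : ℝ) 1, ∀ w ∈ Set.Icc (-(1 : ℝ) / 2) (1 / 2),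
        c * |w| ≤ ‖γ (x + w) - γ x‖ := by
  obtain ⟨x₀, -, hx₀⟩ := (isCompact_Icc (a := (-1 : ℝ)) (b := 2)).exists_isMinOn
    ⟨0, by norm_num⟩ hγ'.norm.continuousOn
  set m := ‖γ' x₀‖
  have hm : 0 < m := norm_pos_iff.mpr (hreg x₀)
  have hm' : ∀ x ∈ Set.Icc (-1 : ℝ) 2, m ≤ ‖γ' x‖ := fun x hx => hx₀ hx
  set δ := min (1 / 2) (m / (2 * (K + 1)))
  have hδ : 0 < δ := by positivity
  have hδ2 : δ ≤ 1 / 2 := min_le_left _ _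
  have hcomp : IsCompact (Set.Icc (0 : ℝ) 1 ×ˢ
      (Set.Icc (-(1 : ℝ) / 2) (1 / 2) ∩ {w | δ ≤ |w|})) :=
    isCompact_Icc.prod (isCompact_Icc.inter_right (isClosed_le continuous_const continuous_abs))
  obtain ⟨z₀, hz₀, hmin⟩ := hcomp.exists_isMinOn
    ⟨(0, 1 / 2), ⟨by norm_num, by norm_num, by simpa [abs_of_pos] using hδ2⟩⟩
    (f := fun z : ℝ × ℝ => ‖γ (z.1 + z.2) - γ z.1‖) (by fun_prop)
  set d := ‖γ (z₀.1 + z₀.2) - γ z₀.1‖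
  have hd : 0 < d := by
    obtain ⟨-, ⟨hw1, hw2⟩, hw3⟩ := hz₀
    refine norm_pos_iff.mpr (increment_ne_zero hper hinj _ (abs_pos.mp (hδ.trans_le hw3)) ?_)
    exact abs_lt.mpr ⟨by linarith, by linarith⟩
  refine ⟨min (m / 2) (2 * d), by positivity,
    fun x hx => (min_le_left _ _).trans ((half_le_self hm.le).trans (hm' x hx)),
    fun x hx w hw => ?_⟩
  by_cases hwδ : δ ≤ |w|
  · have h1 : d ≤ ‖γ (x + w) - γ x‖ := hmin (a := (x, w)) ⟨hx, hw, hwδ⟩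
    have h2 : |w| ≤ 1 / 2 := abs_le.mpr ⟨by linarith [hw.1], hw.2⟩
    calc _ ≤ 2 * d * (1 / 2) := by gcongr; exact min_le_right _ _
      _ = d := by ring
      _ ≤ _ := h1
  · have h1 : |w| ≤ m / (2 * (K + 1)) := (not_le.mp hwδ).le.trans (min_le_right _ _)
    have h2 := htaylor x w
    have h3 : m ≤ ‖γ' x‖ := hm' x ⟨by linarith [hx.1], by linarith [hx.2]⟩
    have h4 : ‖w • γ' x‖ ≤ ‖γ (x + w) - γ x‖ + ‖γ (x + w) - γ x - w • γ' x‖ := by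
      rw [norm_sub_rev _ (w • γ' x)]
      simpa using norm_add_le (γ (x + w) - γ x) (w • γ' x - (γ (x + w) - γ x))
    rw [norm_smul, Real.norm_eq_abs] at h4
    have h5 : K * |w| ≤ m / 2 := by
      rw [le_div_iff₀ (by positivity)] at h1
      nlinarith [abs_nonneg w]
    have h6 : K * |w| ^ 2 ≤ m / 2 * |w| := by
      rw [pow_two, ← mul_assoc]; gcongr
    calc _ ≤ m / 2 * |w| := by gcongr; exact min_le_left _ _
      _ = |w| * m - m / 2 * |w| := by ring
      _ ≤ |w| * ‖γ' x‖ - K * |w| ^ 2 := by gcongr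
      _ ≤ _ := by linarith

/-- The curves `γ + εk` satisfy the increment bounds uniformly for small `ε`. -/
lemma exists_incrementBounds {γ γ' k k' : ℝ → EuclideanSpace ℝ (Fin n)}
    (hγd : ∀ x, HasDerivAt γ (γ' x) x) (hγs : ContDiff ℝ (⊤ : ℕ∞) γ)
    (hγper : ∀ x, γ (x + 1) = γ x) (hreg : ∀ x, γ' x ≠ 0)
    (hinj : Set.InjOn γ (Set.Ico (0 : ℝ) 1))
    (hkd : ∀ x, HasDerivAt k (k' x) x) (hks : ContDiff ℝ (⊤ : ℕ∞) k)
    (hkper : ∀ x, k (x + 1) = k x) :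
    ∃ c K δ : ℝ, 0 < c ∧ 0 ≤ K ∧ 0 < δ ∧
      ∀ ε ∈ Metric.ball (0 : ℝ) δ, ∀ x ∈ Set.Icc (0 : ℝ) 1,
        ∀ w ∈ Set.Ioo (-(1 : ℝ) / 2) (1 / 2),
        IncrementBounds c K w (γ' x + ε • k' x) (γ (x + w) + ε • k (x + w) - (γ x + ε • k x))
          (γ' (x + w) + ε • k' (x + w)) (k' x) (k (x + w) - k x) (k' (x + w)) := by
  obtain ⟨hγ'c, K₁, hK₁, hγ1, -, hγ3⟩ := exists_taylor_bounds hγd hγs hγper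
  obtain ⟨-, K₂, hK₂, hk1, hk2, hk3⟩ := exists_taylor_bounds hkd hks hkper
  obtain ⟨c, hc, hc1, hc2⟩ :=
    exists_le_norm_increment hγs.continuous hγ'c hreg hγper hinj hK₁ hγ3
  refine ⟨c / 2, K₁ + K₂, min 1 (c / (2 * (K₂ + 1))), by positivity, by positivity, by positivity,
    fun ε hε x hx w hw => ?_⟩
  rw [mem_ball_zero_iff, Real.norm_eq_abs, lt_min_iff] at hε
  have hε1 : |ε| ≤ 1 := hε.1.le
  have hε2 : |ε| * K₂ ≤ c / 2 := by
    have := hε.2.le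
    rw [le_div_iff₀ (by positivity)] at this
    nlinarith [abs_nonneg ε]
  have hsm : ∀ (y : EuclideanSpace ℝ (Fin n)) (a : ℝ), ‖y‖ ≤ a → ‖ε • y‖ ≤ |ε| * a :=
    fun y a hy => by rw [norm_smul, Real.norm_eq_abs]; gcongr
  have hsm1 : ∀ (y : EuclideanSpace ℝ (Fin n)) (a : ℝ), ‖y‖ ≤ a → ‖ε • y‖ ≤ a :=
    fun y a hy => (hsm y a hy).trans (mul_le_of_le_one_left ((norm_nonneg y).trans hy) hε1)
  have hlow : ∀ (y z : EuclideanSpace ℝ (Fin n)), ‖y‖ - ‖ε • z‖ ≤ ‖y + ε • z‖ := fun y z => by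
    simpa using norm_sub_norm_le y (-(ε • z))
  have hv : γ (x + w) + ε • k (x + w) - (γ x + ε • k x)
      = (γ (x + w) - γ x) + ε • (k (x + w) - k x) := by module
  have hu_low : ∀ y ∈ Set.Icc (-1 : ℝ) 2, c / 2 ≤ ‖γ' y + ε • k' y‖ := fun y hy => by
    linarith [hlow (γ' y) (k' y), hsm _ _ (hk1 y), hc1 y hy]
  have hu_up : ∀ y, ‖γ' y + ε • k' y‖ ≤ K₁ + K₂ := fun y =>
    (norm_add_le _ _).trans (add_le_add (hγ1 y) (hsm1 _ _ (hk1 y)))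
  refine ⟨hu_low x ⟨by linarith [hx.1], by linarith [hx.2]⟩,
    hu_low _ ⟨by linarith [hx.1, hw.1], by linarith [hx.2, hw.2]⟩, ?_, hu_up _, hu_up _,
    (hk1 _).trans (by linarith), (hk1 _).trans (by linarith),
    (hk2 x w).trans (by gcongr; linarith), ?_, (hk3 x w).trans (by gcongr; linarith)⟩
  · rw [hv]
    have h1 := hlow (γ (x + w) - γ x) (k (x + w) - k x)
    have h2 := hsm _ _ (hk2 x w)
    have h3 := hc2 x hx w ⟨hw.1.le, hw.2.le⟩
    have h4 : |ε| * (K₂ * |w|) ≤ c / 2 * |w| := by rw [← mul_assoc]; gcongr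
    linarith
  · have : γ (x + w) + ε • k (x + w) - (γ x + ε • k x) - w • (γ' x + ε • k' x)
        = (γ (x + w) - γ x - w • γ' x) + ε • (k (x + w) - k x - w • k' x) := by module
    rw [this, add_mul]
    exact (norm_add_le _ _).trans (add_le_add (hγ3 x w) (hsm1 _ _ (hk3 x w)))

end PeriodicCurves

section Integrability

lemma integrableOn_abs_rpow {r : ℝ} (hr : -1 < r) :
    IntegrableOn (fun w : ℝ => |w| ^ r) (Set.Ioo (-(1 : ℝ) / 2) (1 / 2)) := by
  have hpos : IntervalIntegrable (fun w : ℝ => |w| ^ r) volume 0 (1 / 2) := by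
    refine (intervalIntegral.intervalIntegrable_rpow' hr).congr fun w hw => ?_
    rw [Set.uIoc_of_le (by norm_num)] at hw
    simp only [abs_of_pos hw.1]
  have hneg : IntervalIntegrable (fun w : ℝ => |w| ^ r) volume (-(1 / 2)) 0 := by
    have := (IntervalIntegrable.iff_comp_neg (by simp)).mp hpos
    simpa using this.symm
  rw [← intervalIntegrable_iff_integrableOn_Ioo_of_le (by norm_num)]
  rw [neg_div]
  exact hneg.trans hpos

/-- The product measure on `[0,1] × (-1/2,1/2)` underlying the double integrals. -/
noncomputable def incrementMeasure : Measure (ℝ × ℝ) :=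
  (volume.restrict (Set.Icc (0 : ℝ) 1)).prod
    (volume.restrict (Set.Ioo (-(1 : ℝ) / 2) (1 / 2)))

lemma ae_incrementMeasure :
    ∀ᵐ z ∂incrementMeasure, z.1 ∈ Set.Icc (0 : ℝ) 1 ∧
      z.2 ∈ Set.Ioo (-(1 : ℝ) / 2) (1 / 2) ∧ z.2 ≠ 0 := by
  have h1 : ∀ᵐ x ∂(volume.restrict (Set.Icc (0 : ℝ) 1)), x ∈ Set.Icc (0 : ℝ) 1 :=
    ae_restrict_mem measurableSet_Icc
  have h2 : ∀ᵐ w ∂(volume.restrict (Set.Ioo (-(1 : ℝ) / 2) (1 / 2))),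
      w ∈ Set.Ioo (-(1 : ℝ) / 2) (1 / 2) ∧ w ≠ 0 :=
    (ae_restrict_mem measurableSet_Ioo).and (Measure.ae_ne _ 0)
  exact (Measure.quasiMeasurePreserving_fst.ae h1).and (Measure.quasiMeasurePreserving_snd.ae h2)

lemma integrable_abs_rpow_incrementMeasure {r : ℝ} (hr : -1 < r) (C : ℝ) :
    Integrable (fun z : ℝ × ℝ => C * |z.2| ^ r) incrementMeasure :=
  ((integrableOn_abs_rpow hr).comp_snd _).const_mul C

end Integrability

section Algebra

variable {n : ℕ} (γ γ' k k' : ℝ → EuclideanSpace ℝ (Fin n)) (x w : ℝ)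

lemma Lg_eq : Lg γ γ' k k' x w = (k (x + w) - k x) -
    (⟪γ' x, γ (x + w) - γ x⟫ / ‖γ' x‖ ^ 2) • k' x := by
  rw [Lg, Dg, Dg, inner_smul_left, smul_smul]
  congr 2
  simp only [conj_trivial]
  ring

lemma Lg_self_eq : Lg γ γ' γ γ' x w = Pperp (γ' x) (γ (x + w) - γ x) :=
  Lg_eq γ γ' γ γ' x w

lemma inner_Dg_Dg (y : ℝ) : ⟪Dg γ' γ' y, Dg γ' k' y⟫ = ⟪γ' y, k' y⟫ / ‖γ' y‖ ^ 2 := by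
  rw [Dg, Dg, inner_smul_left, inner_smul_right]
  simp only [conj_trivial]
  ring

variable {γ γ' k k' x w}

/-- Passing from the weights `Ω^s` and `dμ_γ` to the explicit power `|Δ_w γ|^(2s+3)`. -/
lemma inner_Om_mul_dens {s : ℝ} (hs : 0 < s) (b g : ℝ) :
    ⟪Om s γ γ' γ γ' x w, Om s γ γ' k k' x w⟫ * (b / ‖γ (x + w) - γ x‖ ^ 2) * g * dens γ γ' x w
      = ⟪Lg γ γ' γ γ' x w, Lg γ γ' k k' x w⟫ / ‖γ (x + w) - γ x‖ ^ (2 * s + 3) * b *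
        (g * (‖γ' x‖ * ‖γ' (x + w)‖)) := by
  rw [Om, Om, dens, inner_smul_left, inner_smul_right]
  simp only [conj_trivial]
  rcases (norm_nonneg (γ (x + w) - γ x)).eq_or_lt' with h | h
  · rw [h, Real.zero_rpow (show s ≠ 0 by positivity),
      Real.zero_rpow (show 2 * s + 3 ≠ 0 by positivity)]
    simp
  · rw [Real.rpow_add h, two_mul, Real.rpow_add h, show (3 : ℝ) = ((3 : ℕ) : ℝ) by norm_num,
      Real.rpow_natCast]
    have := (Real.rpow_pos_of_pos h s).ne'
    field_simp

end Algebra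

/-- Derivative of `B²` with respect to the base curve:
`d/dε|₀ B²_{γ+εk}(ψ₁,ψ₂)` equals the three-term expression `(DB²(γ)k)(ψ₁,ψ₂)`. -/
theorem stmt8 {n : ℕ} (hn : 2 ≤ n) (s : ℝ) (hs : s ∈ Set.Ioo (3/2 : ℝ) 2)
    (γ γ' k k' ψ₁ ψ₂ : ℝ → EuclideanSpace ℝ (Fin n))
    (hγd : ∀ x, HasDerivAt γ (γ' x) x) (hγs : ContDiff ℝ (⊤ : ℕ∞) γ)
    (hγper : ∀ x, γ (x + 1) = γ x)
    (hreg : ∀ x, γ' x ≠ 0)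
    (hinj : Set.InjOn γ (Set.Ico (0:ℝ) 1))
    (hkd : ∀ x, HasDerivAt k (k' x) x) (hks : ContDiff ℝ (⊤ : ℕ∞) k)
    (hkper : ∀ x, k (x + 1) = k x)
    (hψ₁s : ContDiff ℝ (⊤ : ℕ∞) ψ₁) (hψ₁per : ∀ x, ψ₁ (x + 1) = ψ₁ x)
    (hψ₂s : ContDiff ℝ (⊤ : ℕ∞) ψ₂) (hψ₂per : ∀ x, ψ₂ (x + 1) = ψ₂ x) :
    HasDerivAt
      (fun ε : ℝ =>
        B2 s (fun x => γ x + ε • k x) (fun x => γ' x + ε • k' x) ψ₁ ψ₂)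
      (-(2 * s + 3) * (∫ x in Set.Icc (0:ℝ) 1, ∫ w in Set.Ioo (-(1:ℝ)/2) (1/2),
          ‖Om s γ γ' γ γ' x w‖ ^ 2 *
            (⟪ψ₁ (x + w) - ψ₁ x, ψ₂ (x + w) - ψ₂ x⟫ / ‖γ (x + w) - γ x‖ ^ 2) *
            (⟪γ (x + w) - γ x, k (x + w) - k x⟫ / ‖γ (x + w) - γ x‖ ^ 2) *
            dens γ γ' x w)
        + 2 * (∫ x in Set.Icc (0:ℝ) 1, ∫ w in Set.Ioo (-(1:ℝ)/2) (1/2),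
            ⟪Om s γ γ' γ γ' x w, Om s γ γ' k k' x w⟫ *
              (⟪ψ₁ (x + w) - ψ₁ x, ψ₂ (x + w) - ψ₂ x⟫ / ‖γ (x + w) - γ x‖ ^ 2) *
              dens γ γ' x w)
        + ∫ x in Set.Icc (0:ℝ) 1, ∫ w in Set.Ioo (-(1:ℝ)/2) (1/2),
            ‖Om s γ γ' γ γ' x w‖ ^ 2 *
              (⟪ψ₁ (x + w) - ψ₁ x, ψ₂ (x + w) - ψ₂ x⟫ / ‖γ (x + w) - γ x‖ ^ 2) *
              (⟪Dg γ' γ' x, Dg γ' k' x⟫ + ⟪Dg γ' γ' (x + w), Dg γ' k' (x + w)⟫) *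
              dens γ γ' x w)
      0 := by
  obtain ⟨hs1, hs2⟩ := hs
  have hs0 : 0 < s := by linarith
  have hr : -1 < 6 - (2 * s + 3) := by linarith
  obtain ⟨c, K, δ, hc, hK, hδ, hbounds⟩ :=
    exists_incrementBounds hγd hγs hγper hreg hinj hkd hks hkper
  have hγ'c : Continuous γ' := (exists_taylor_bounds hγd hγs hγper).1
  have hk'c : Continuous k' := (exists_taylor_bounds hkd hks hkper).1
  have hψ₁c := hψ₁s.continuous
  have hψ₂c := hψ₂s.continuous
  have hγm := hγs.continuous.measurable
  have hkm := hks.continuous.measurable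
  have hγ'm := hγ'c.measurable
  have hk'm := hk'c.measurable
  have hψ₁m := hψ₁c.measurable
  have hψ₂m := hψ₂c.measurable
  obtain ⟨-, M₁, hM₁, -, hψ₁lip, -⟩ := exists_taylor_bounds
    (fun x => ((contDiff_infty_iff_deriv.mp hψ₁s).1 x).hasDerivAt) hψ₁s hψ₁per
  obtain ⟨-, M₂, hM₂, -, hψ₂lip, -⟩ := exists_taylor_bounds
    (fun x => ((contDiff_infty_iff_deriv.mp hψ₂s).1 x).hasDerivAt) hψ₂s hψ₂per
  let b : ℝ × ℝ → ℝ := fun z => ⟪ψ₁ (z.1 + z.2) - ψ₁ z.1, ψ₂ (z.1 + z.2) - ψ₂ z.1⟫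
  have hb : ∀ z, |b z| ≤ max K (M₁ * M₂) * |z.2| ^ 2 := fun z => by
    calc |b z| ≤ ‖ψ₁ (z.1 + z.2) - ψ₁ z.1‖ * ‖ψ₂ (z.1 + z.2) - ψ₂ z.1‖ :=
          abs_real_inner_le_norm _ _
      _ ≤ (M₁ * |z.2|) * (M₂ * |z.2|) := by
          gcongr
          · exact hψ₁lip _ _
          · exact hψ₂lip _ _
      _ = M₁ * M₂ * |z.2| ^ 2 := by ring
      _ ≤ _ := by gcongr; exact le_max_right _ _
  obtain ⟨C, hC⟩ := exists_forall_B2_terms_le (n := n) (p := 2 * s + 3) (by linarith) hc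
    (le_max_of_le_left hK : 0 ≤ max K (M₁ * M₂))
  let U : ℝ → ℝ → EuclideanSpace ℝ (Fin n) := fun ε x => γ' x + ε • k' x
  let V : ℝ → ℝ × ℝ → EuclideanSpace ℝ (Fin n) := fun ε z =>
    γ (z.1 + z.2) + ε • k (z.1 + z.2) - (γ z.1 + ε • k z.1)
  let V' : ℝ × ℝ → EuclideanSpace ℝ (Fin n) := fun z => k (z.1 + z.2) - k z.1
  let F : ℝ → ℝ × ℝ → ℝ := fun ε z =>
    ‖Pperp (U ε z.1) (V ε z)‖ ^ 2 / ‖V ε z‖ ^ (2 * s + 3) * b z *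
      (‖U ε z.1‖ * ‖U ε (z.1 + z.2)‖)
  let T₁ : ℝ → ℝ × ℝ → ℝ := fun ε z =>
    ‖Pperp (U ε z.1) (V ε z)‖ ^ 2 / ‖V ε z‖ ^ (2 * s + 3) * b z *
      (⟪V ε z, V' z⟫ / ‖V ε z‖ ^ 2 * (‖U ε z.1‖ * ‖U ε (z.1 + z.2)‖))
  let T₂ : ℝ → ℝ × ℝ → ℝ := fun ε z =>
    ⟪Pperp (U ε z.1) (V ε z), V' z - (⟪U ε z.1, V ε z⟫ / ‖U ε z.1‖ ^ 2) • k' z.1⟫ /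
      ‖V ε z‖ ^ (2 * s + 3) * b z * (‖U ε z.1‖ * ‖U ε (z.1 + z.2)‖)
  let T₃ : ℝ → ℝ × ℝ → ℝ := fun ε z =>
    ‖Pperp (U ε z.1) (V ε z)‖ ^ 2 / ‖V ε z‖ ^ (2 * s + 3) * b z *
      ((⟪U ε z.1, k' z.1⟫ / ‖U ε z.1‖ ^ 2 +
        ⟪U ε (z.1 + z.2), k' (z.1 + z.2)⟫ / ‖U ε (z.1 + z.2)‖ ^ 2) *
          (‖U ε z.1‖ * ‖U ε (z.1 + z.2)‖))
  have hIB : ∀ ε ∈ Metric.ball (0 : ℝ) δ, ∀ z : ℝ × ℝ, z.1 ∈ Set.Icc (0 : ℝ) 1 →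
      z.2 ∈ Set.Ioo (-(1 : ℝ) / 2) (1 / 2) →
      IncrementBounds c K z.2 (U ε z.1) (V ε z) (U ε (z.1 + z.2)) (k' z.1) (V' z)
        (k' (z.1 + z.2)) :=
    fun ε hε z hx hw => hbounds ε hε z.1 hx z.2 hw
  have hle := fun ε hε (z : ℝ × ℝ) hx hw (hw0 : z.2 ≠ 0) =>
    hC z.2 (b z) _ _ _ _ _ _ hw0 ((hIB ε hε z hx hw).mono (le_max_left K (M₁ * M₂))) (hb z)
  have hUm : ∀ ε, Measurable (U ε) := fun ε => by fun_prop
  have hVm : ∀ ε, Measurable (V ε) := fun ε => by fun_prop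
  have hV'm : Measurable V' := by fun_prop
  have hbm : Measurable b := by fun_prop
  have hFm : ∀ ε, Measurable (F ε) := fun ε => by
    have := hUm ε; have := hVm ε
    simp only [F, Pperp]
    fun_prop
  have hT₁m : ∀ ε, Measurable (T₁ ε) := fun ε => by
    have := hUm ε; have := hVm ε
    simp only [T₁, Pperp]
    fun_prop
  have hT₂m : ∀ ε, Measurable (T₂ ε) := fun ε => by
    have := hUm ε; have := hVm ε
    simp only [T₂, Pperp]
    fun_prop
  have hT₃m : ∀ ε, Measurable (T₃ ε) := fun ε => by
    have := hUm ε; have := hVm ε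
    simp only [T₃, Pperp]
    fun_prop
  have hdom : ∀ f : ℝ × ℝ → ℝ, Measurable f →
      (∀ z : ℝ × ℝ, z.1 ∈ Set.Icc (0 : ℝ) 1 → z.2 ∈ Set.Ioo (-(1 : ℝ) / 2) (1 / 2) → z.2 ≠ 0 →
        |f z| ≤ C * |z.2| ^ (6 - (2 * s + 3))) → Integrable f incrementMeasure :=
    fun f hf hfle => (integrable_abs_rpow_incrementMeasure hr C).mono' hf.aestronglyMeasurable
      (ae_incrementMeasure.mono fun z hz => hfle z hz.1 hz.2.1 hz.2.2)
  have hFi : ∀ ε ∈ Metric.ball (0 : ℝ) δ, Integrable (F ε) incrementMeasure := fun ε hε =>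
    hdom _ (hFm ε) fun z hx hw hw0 => (hle ε hε z hx hw hw0).1
  have h0 : (0 : ℝ) ∈ Metric.ball (0 : ℝ) δ := Metric.mem_ball_self hδ
  have hT₁i : Integrable (T₁ 0) incrementMeasure :=
    hdom _ (hT₁m 0) fun z hx hw hw0 => (hle 0 h0 z hx hw hw0).2.1
  have hT₂i : Integrable (T₂ 0) incrementMeasure :=
    hdom _ (hT₂m 0) fun z hx hw hw0 => (hle 0 h0 z hx hw hw0).2.2.1
  have hT₃i : Integrable (T₃ 0) incrementMeasure :=
    hdom _ (hT₃m 0) fun z hx hw hw0 => (hle 0 h0 z hx hw hw0).2.2.2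
  have hderiv : HasDerivAt (fun ε => ∫ z, F ε z ∂incrementMeasure)
      (∫ z, (-(2 * s + 3) * T₁ 0 z + 2 * T₂ 0 z + T₃ 0 z) ∂incrementMeasure) 0 := by
    refine (hasDerivAt_integral_of_dominated_loc_of_deriv_le
      (F' := fun ε z => -(2 * s + 3) * T₁ ε z + 2 * T₂ ε z + T₃ ε z)
      (bound := fun z => ((2 * s + 3) + 2 + 1) * C * |z.2| ^ (6 - (2 * s + 3)))
      (Metric.ball_mem_nhds 0 hδ) (.of_forall fun ε => (hFm ε).aestronglyMeasurable)
      (hFi 0 h0) ?_ ?_ (integrable_abs_rpow_incrementMeasure hr _) ?_).2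
    · exact ((((hT₁m 0).const_mul _).add ((hT₂m 0).const_mul _)).add (hT₃m 0)).aestronglyMeasurable
    · filter_upwards [ae_incrementMeasure] with z hz ε hε
      obtain ⟨-, h1, h2, h3⟩ := hle ε hε z hz.1 hz.2.1 hz.2.2
      calc _ ≤ |-(2 * s + 3) * T₁ ε z| + |2 * T₂ ε z| + |T₃ ε z| := abs_add_three _ _ _
        _ = (2 * s + 3) * |T₁ ε z| + 2 * |T₂ ε z| + |T₃ ε z| := by
          rw [abs_mul (-(2 * s + 3)), abs_mul 2, abs_neg, abs_of_pos (by positivity : 0 < 2 * s + 3), abs_two]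
        _ ≤ (2 * s + 3) * (C * |z.2| ^ (6 - (2 * s + 3))) +
            2 * (C * |z.2| ^ (6 - (2 * s + 3))) + C * |z.2| ^ (6 - (2 * s + 3)) := by
          gcongr
        _ = _ := by ring
    · filter_upwards [ae_incrementMeasure] with z hz ε hε
      have hB := hIB ε hε z hz.1 hz.2.1
      have hline : ∀ y d : EuclideanSpace ℝ (Fin n),
          HasDerivAt (fun ε : ℝ => y + ε • d) d ε := fun y d =>
        (((hasDerivAt_id ε).smul_const d).const_add y).congr_deriv (one_smul ℝ d)
      exact hasDerivAt_B2_integrand (2 * s + 3) (b z) (hline _ _)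
        ((hline _ _).fun_sub (hline _ _)) (hline _ _)
        (norm_pos_iff.mp (hc.trans_le hB.le_norm_u))
        (norm_pos_iff.mp ((mul_pos hc (abs_pos.mpr hz.2.2)).trans_le hB.le_norm_v))
        (norm_pos_iff.mp (hc.trans_le hB.le_norm_u₂))
  have hsplit : ∫ z, (-(2 * s + 3) * T₁ 0 z + 2 * T₂ 0 z + T₃ 0 z) ∂incrementMeasure
      = -(2 * s + 3) * (∫ z, T₁ 0 z ∂incrementMeasure) + 2 * (∫ z, T₂ 0 z ∂incrementMeasure)
        + ∫ z, T₃ 0 z ∂incrementMeasure := by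
    have h₁ : Integrable (fun z => -(2 * s + 3) * T₁ 0 z) incrementMeasure := hT₁i.const_mul _
    have h₂ : Integrable (fun z => 2 * T₂ 0 z) incrementMeasure := hT₂i.const_mul _
    have h₁₂ : Integrable (fun z => -(2 * s + 3) * T₁ 0 z + 2 * T₂ 0 z) incrementMeasure :=
      h₁.add h₂
    rw [integral_add h₁₂ hT₃i, integral_add h₁ h₂, integral_const_mul, integral_const_mul]
  rw [hsplit, incrementMeasure, integral_prod _ hT₁i, integral_prod _ hT₂i,
    integral_prod _ hT₃i] at hderiv
  have hB2 : (fun ε : ℝ => B2 s (fun x => γ x + ε • k x) (fun x => γ' x + ε • k' x) ψ₁ ψ₂)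
      =ᶠ[nhds 0] fun ε => ∫ z, F ε z ∂incrementMeasure := by
    filter_upwards [Metric.ball_mem_nhds 0 hδ] with ε hε
    rw [incrementMeasure, integral_prod _ (hFi ε hε)]
    rfl
  refine (hderiv.congr_of_eventuallyEq hB2).congr_deriv ?_
  have hU0 : ∀ x, U 0 x = γ' x := fun x => by simp [U]
  have hV0 : ∀ z, V 0 z = γ (z.1 + z.2) - γ z.1 := fun z => by simp [V]
  have e₁ : ∀ x w, T₁ 0 (x, w) = ‖Om s γ γ' γ γ' x w‖ ^ 2 *
      (⟪ψ₁ (x + w) - ψ₁ x, ψ₂ (x + w) - ψ₂ x⟫ / ‖γ (x + w) - γ x‖ ^ 2) *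
      (⟪γ (x + w) - γ x, k (x + w) - k x⟫ / ‖γ (x + w) - γ x‖ ^ 2) * dens γ γ' x w := by
    intro x w
    rw [← real_inner_self_eq_norm_sq, inner_Om_mul_dens hs0, real_inner_self_eq_norm_sq, Lg_self_eq]
    simp only [T₁, hU0, hV0, b, V']
  have e₂ : ∀ x w, T₂ 0 (x, w) = ⟪Om s γ γ' γ γ' x w, Om s γ γ' k k' x w⟫ *
      (⟪ψ₁ (x + w) - ψ₁ x, ψ₂ (x + w) - ψ₂ x⟫ / ‖γ (x + w) - γ x‖ ^ 2) * dens γ γ' x w := by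
    intro x w
    rw [← mul_one (⟪Om s γ γ' γ γ' x w, Om s γ γ' k k' x w⟫ * _), inner_Om_mul_dens hs0,
      Lg_self_eq, Lg_eq, one_mul]
    simp only [T₂, hU0, hV0, b, V']
  have e₃ : ∀ x w, T₃ 0 (x, w) = ‖Om s γ γ' γ γ' x w‖ ^ 2 *
      (⟪ψ₁ (x + w) - ψ₁ x, ψ₂ (x + w) - ψ₂ x⟫ / ‖γ (x + w) - γ x‖ ^ 2) *
      (⟪Dg γ' γ' x, Dg γ' k' x⟫ + ⟪Dg γ' γ' (x + w), Dg γ' k' (x + w)⟫) * dens γ γ' x w := by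
    intro x w
    rw [← real_inner_self_eq_norm_sq, inner_Om_mul_dens hs0, real_inner_self_eq_norm_sq,
      Lg_self_eq, inner_Dg_Dg, inner_Dg_Dg]
    simp only [T₃, hU0, hV0, b]
  simp only [e₁, e₂, e₃]
end
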